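/- arXiv:2108.10979 — 9 statements merged into one kernel-verified Lean document; each statement's English description precedes it below -/
import Mathlib

section
/- Let W(J, J̄) be an entire function of the pair of tensor variables as in the context, and fix a slot i ∈ Fin d. Suppose W is invariant under the unitary group acting on slot i, i.e. for every unitary N×N complex matrix U and all (J, J̄) one has W(U·ᵢJ, conj(U)·ᵢJ̄) = W(J, J̄), where (U·ᵢJ)_p := Σ_{q ∈ Fin N} U_{p_i q} J_{p[i↦q]} and conj(U) is the entrywise complex conjugate matrix. Then the first-order Ward–Takahashi identity in slot i holds: for all a, b ∈ Fin N and all (J, J̄), Σ_{p : p_i = a} ( J̄_p · M_{p[i↦b]} − M̄_p · J_{p[i↦b]} ) = 0. -/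
open scoped BigOperators

/-- Multi-indices `p ∈ (Fin N)^d`. -/
abbrev Idx (d N : ℕ) := Fin d → Fin N

/-- Tensors `J : (Fin N)^d → ℂ`. -/
abbrev Tensor (d N : ℕ) := Idx d N → ℂ

/-- The pair of source variables `(J, J̄)`. -/
abbrev Src (d N : ℕ) := Tensor d N × Tensor d N

/-- Unit direction in the `J` variable at index `p`. -/
noncomputable def eJ (d N : ℕ) (p : Idx d N) : Src d N := (Pi.single p 1, 0)

/-- Unit direction in the `J̄` variable at index `p`. -/
noncomputable def eJbar (d N : ℕ) (p : Idx d N) : Src d N := (0, Pi.single p 1)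

/-- `M_p = ∂W/∂J̄_p`. -/
noncomputable def Mfun {d N : ℕ} (W : Src d N → ℂ) (p : Idx d N) (x : Src d N) : ℂ :=
  fderiv ℂ W x (eJbar d N p)

/-- `M̄_p = ∂W/∂J_p`. -/
noncomputable def Mbarfun {d N : ℕ} (W : Src d N → ℂ) (p : Idx d N) (x : Src d N) : ℂ :=
  fderiv ℂ W x (eJ d N p)

/-- Action of an `N × N` matrix on slot `i` of a tensor:
`(U ·ᵢ J)_p = Σ_q U_{p_i q} J_{p[i↦q]}`. -/
noncomputable def actSlot {d N : ℕ} (i : Fin d) (U : Matrix (Fin N) (Fin N) ℂ)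
    (J : Tensor d N) : Tensor d N :=
  fun p => ∑ q : Fin N, U (p i) q * J (Function.update p i q)

section EntryDeriv

attribute [local instance] Matrix.linftyOpNormedRing Matrix.linftyOpNormedAlgebra

theorem Matrix.hasDerivAt_exp_smul_apply {n : Type*} [Fintype n] [DecidableEq n]
    (A : Matrix n n ℂ) (j k : n) :
    HasDerivAt (fun t : ℝ => NormedSpace.exp (t • A) j k) (A j k) 0 := by
  have h := hasDerivAt_exp_smul_const (𝕂 := ℝ) A 0
  simp only [zero_smul, NormedSpace.exp_zero, one_mul] at h
  exact hasDerivAt_pi.1 (hasDerivAt_pi.1 h j) k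

end EntryDeriv

theorem Matrix.exp_smul_mem_unitaryGroup {n : Type*} [Fintype n] [DecidableEq n]
    {A : Matrix n n ℂ} (hA : A.conjTranspose = -A) (t : ℝ) :
    NormedSpace.exp (t • A) ∈ Matrix.unitaryGroup n ℂ := by
  rw [Matrix.mem_unitaryGroup_iff, Matrix.star_eq_conjTranspose, ← Matrix.exp_conjTranspose,
    Matrix.conjTranspose_smul, hA, star_trivial, smul_neg, Matrix.exp_neg]
  exact Matrix.mul_nonsing_inv _ ((Matrix.isUnit_iff_isUnit_det _).1 (Matrix.isUnit_exp _))

theorem hasDerivAt_actSlot {d N : ℕ} (i : Fin d) {U : ℝ → Matrix (Fin N) (Fin N) ℂ}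
    {A : Matrix (Fin N) (Fin N) ℂ} {t : ℝ}
    (hU : ∀ j k, HasDerivAt (fun s => U s j k) (A j k) t) (J : Tensor d N) :
    HasDerivAt (fun s => actSlot i (U s) J) (actSlot i A J) t :=
  hasDerivAt_pi.2 fun p => HasDerivAt.fun_sum fun q _ => (hU (p i) q).mul_const _

theorem actSlot_add {d N : ℕ} (i : Fin d) (A B : Matrix (Fin N) (Fin N) ℂ) (J : Tensor d N) :
    actSlot i (A + B) J = actSlot i A J + actSlot i B J := by
  ext p
  simp [actSlot, add_mul, Finset.sum_add_distrib]

theorem actSlot_smul {d N : ℕ} (i : Fin d) (c : ℂ) (A : Matrix (Fin N) (Fin N) ℂ)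
    (J : Tensor d N) : actSlot i (c • A) J = c • actSlot i A J := by
  ext p
  simp [actSlot, mul_assoc, Finset.mul_sum]

theorem actSlot_single {d N : ℕ} (i : Fin d) (a b : Fin N) (J : Tensor d N) :
    actSlot i (Matrix.single a b 1) J =
      ∑ p ∈ Finset.univ.filter (fun p : Idx d N => p i = a),
        J (Function.update p i b) • (Pi.single p 1 : Tensor d N) := by
  ext r
  rw [Finset.sum_apply, Finset.sum_filter, Finset.sum_eq_single r]
  · by_cases h : a = r i <;> simp [actSlot, Matrix.single_apply, h, eq_comm]
  · intro p _ hp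
    simp [Pi.single_eq_of_ne' hp]
  · simp

/-- The first-order variation of the sources `(J, J̄)` under the complexified action of the
matrix `A` on slot `i`. -/
noncomputable def slotGenerator {d N : ℕ} (i : Fin d) (x : Src d N) :
    Matrix (Fin N) (Fin N) ℂ →ₗ[ℂ] Src d N where
  toFun A := (actSlot i A x.1, -actSlot i A.transpose x.2)
  map_add' A B := by simp [actSlot_add, add_comm]
  map_smul' c A := by simp [actSlot_smul]

theorem fderiv_slotGenerator_of_skewHermitian {d N : ℕ} {W : Src d N → ℂ} {i : Fin d}
    {x : Src d N} (hW : DifferentiableAt ℂ W x)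
    (hinv : ∀ U : Matrix (Fin N) (Fin N) ℂ, U ∈ Matrix.unitaryGroup (Fin N) ℂ →
      W (actSlot i U x.1, actSlot i (U.map (starRingEnd ℂ)) x.2) = W x)
    {A : Matrix (Fin N) (Fin N) ℂ} (hA : A.conjTranspose = -A) :
    fderiv ℂ W x (slotGenerator i x A) = 0 := by
  have h1 := hasDerivAt_actSlot i (Matrix.hasDerivAt_exp_smul_apply A) x.1
  have h2 : HasDerivAt
      (fun t : ℝ => actSlot i ((NormedSpace.exp (t • A)).map (starRingEnd ℂ)) x.2)
      (-actSlot i A.transpose x.2) 0 := by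
    have hconj : A.map (starRingEnd ℂ) = (-1 : ℂ) • A.transpose := by
      ext j k
      simpa using congrFun (congrFun hA k) j
    have := hasDerivAt_actSlot i (U := fun t : ℝ => (NormedSpace.exp (t • A)).map (starRingEnd ℂ))
      (A := A.map (starRingEnd ℂ)) (t := 0)
      (fun j k => (Matrix.hasDerivAt_exp_smul_apply A j k).star) x.2
    rwa [hconj, actSlot_smul, neg_one_smul] at this
  have hone : ∀ J : Tensor d N, actSlot i 1 J = J := fun J => by
    ext p
    simp [actSlot, Matrix.one_apply]
  have hx : (actSlot i (NormedSpace.exp ((0 : ℝ) • A)) x.1,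
      actSlot i ((NormedSpace.exp ((0 : ℝ) • A)).map (starRingEnd ℂ)) x.2) = x := by
    simp [hone]
  have hcomp := (hx.symm ▸ hW.hasFDerivAt.restrictScalars ℝ :
    HasFDerivAt W _ _).comp_hasDerivAt (0 : ℝ) (h1.prodMk h2)
  have hconst : (W ∘ fun t : ℝ => (actSlot i (NormedSpace.exp (t • A)) x.1,
      actSlot i ((NormedSpace.exp (t • A)).map (starRingEnd ℂ)) x.2)) = fun _ => W x :=
    funext fun t => hinv _ (Matrix.exp_smul_mem_unitaryGroup hA t)
  rw [hconst] at hcomp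
  have hzero := hcomp.unique (hasDerivAt_const _ _)
  rw [hx] at hzero
  exact hzero

theorem fderiv_slotGenerator {d N : ℕ} {W : Src d N → ℂ} {i : Fin d}
    {x : Src d N} (hW : DifferentiableAt ℂ W x)
    (hinv : ∀ U : Matrix (Fin N) (Fin N) ℂ, U ∈ Matrix.unitaryGroup (Fin N) ℂ →
      W (actSlot i U x.1, actSlot i (U.map (starRingEnd ℂ)) x.2) = W x)
    (A : Matrix (Fin N) (Fin N) ℂ) :
    fderiv ℂ W x (slotGenerator i x A) = 0 := by
  have hdecomp : A = (1 / 2 : ℂ) • (A - A.conjTranspose) +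
      (-Complex.I / 2) • (Complex.I • (A + A.conjTranspose)) := by
    ext j k
    simp
    linear_combination (A j k + starRingEnd ℂ (A k j)) / 2 * Complex.I_mul_I
  rw [hdecomp, map_add, map_smul, map_smul, map_add, map_smul, map_smul,
    fderiv_slotGenerator_of_skewHermitian hW hinv (by simp),
    fderiv_slotGenerator_of_skewHermitian hW hinv (by simp [add_comm])]
  simp

/-- if the entire function `W(J, J̄)` is invariant under the unitary
group acting on slot `i` (with the conjugate matrix acting on `J̄`), then the
first-order Ward–Takahashi identity holds in slot `i`. -/
theorem ward_takahashi_first_order_of_unitary_invariance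
    (d N : ℕ) (hd : 1 ≤ d) (hN : 1 ≤ N)
    (W : Src d N → ℂ) (hW : AnalyticOnNhd ℂ W Set.univ)
    (i : Fin d)
    (hinv : ∀ U : Matrix (Fin N) (Fin N) ℂ, U ∈ Matrix.unitaryGroup (Fin N) ℂ →
      ∀ x : Src d N,
        W (actSlot i U x.1, actSlot i (U.map (starRingEnd ℂ)) x.2) = W x) :
    ∀ a b : Fin N, ∀ x : Src d N,
      ∑ p ∈ Finset.univ.filter (fun p : Idx d N => p i = a),
        (x.2 p * Mfun W (Function.update p i b) x
          - Mbarfun W p x * x.1 (Function.update p i b)) = 0 := by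
  intro a b x
  have hgen := fderiv_slotGenerator (hW x (Set.mem_univ x)).differentiableAt
    (fun U hU => hinv U hU x) (Matrix.single a b 1)
  have hsplit : slotGenerator i x (Matrix.single a b 1) =
      ∑ p ∈ Finset.univ.filter (fun p : Idx d N => p i = a),
        x.1 (Function.update p i b) • eJ d N p -
      ∑ p ∈ Finset.univ.filter (fun p : Idx d N => p i = b),
        x.2 (Function.update p i a) • eJbar d N p := by
    ext : 1 <;>
      simp [slotGenerator, actSlot_single, eJ, eJbar, Prod.fst_sum, Prod.snd_sum]
  have hreindex : ∑ p ∈ Finset.univ.filter (fun p : Idx d N => p i = b),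
        x.2 (Function.update p i a) * Mfun W p x =
      ∑ p ∈ Finset.univ.filter (fun p : Idx d N => p i = a),
        x.2 p * Mfun W (Function.update p i b) x := by
    refine Finset.sum_nbij' (fun p => Function.update p i a) (fun p => Function.update p i b)
      ?_ ?_ ?_ ?_ ?_ <;> intro p hp <;> simp at hp ⊢ <;> simp [← hp]
  rw [hsplit, map_sub, map_sum, map_sum] at hgen
  simp only [map_smul, smul_eq_mul] at hgen
  rw [Finset.sum_sub_distrib, ← hreindex, ← neg_eq_zero, neg_sub, ← hgen]
  simp only [Mfun, Mbarfun, mul_comm]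
end

section
/- Let W(J, J̄) be an entire function of the pair of tensor variables as in the context. If the first-order Ward–Takahashi identity holds in every slot i ∈ Fin d (for all a, b ∈ Fin N, identically in (J, J̄)), then the two-point function is diagonal: for all p, q ∈ (Fin N)^d with p ≠ q one has G^{(1,1)}(p,q) evaluated at (J, J̄) = (0, 0) equal to 0. -/
open scoped BigOperators

/-- `G^{(1,1)}(p,q) = ∂²W/∂J_p∂J̄_q`. -/
noncomputable def G11 {d N : ℕ} (W : Src d N → ℂ) (p q : Idx d N) (x : Src d N) : ℂ :=
  fderiv ℂ (fun y => fderiv ℂ W y (eJ d N p)) x (eJbar d N q)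

/-- `G^{(2,0)}(p,q) = ∂²W/∂J_p∂J_q`. -/
noncomputable def G20 {d N : ℕ} (W : Src d N → ℂ) (p q : Idx d N) (x : Src d N) : ℂ :=
  fderiv ℂ (fun y => fderiv ℂ W y (eJ d N p)) x (eJ d N q)

/-- `G^{(0,2)}(p,q) = ∂²W/∂J̄_p∂J̄_q`. -/
noncomputable def G02 {d N : ℕ} (W : Src d N → ℂ) (p q : Idx d N) (x : Src d N) : ℂ :=
  fderiv ℂ (fun y => fderiv ℂ W y (eJbar d N p)) x (eJbar d N q)

/-- The first-order Ward–Takahashi identity in slot `i`. -/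
def WardId {d N : ℕ} (W : Src d N → ℂ) (i : Fin d) : Prop :=
  ∀ a b : Fin N, ∀ x : Src d N,
    ∑ p ∈ Finset.univ.filter (fun p : Idx d N => p i = a),
      (x.2 p * Mfun W (Function.update p i b) x
        - Mbarfun W p x * x.1 (Function.update p i b)) = 0

/-- The Ward–Takahashi identity with `a = b = q i` forces `M_q` to vanish along the line through
the origin in a direction `J_p` with `p i ≠ q i`. -/
theorem Mfun_smul_eJ_eq_zero {d N : ℕ} {W : Src d N → ℂ} (hW : ContDiff ℂ 1 W) {i : Fin d}
    (hward : WardId W i) {p q : Idx d N} (hpq : p i ≠ q i) (t : ℂ) :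
    Mfun W q (t • eJ d N p) = 0 := by
  have hM : Continuous (Mfun W q) :=
    (hW.continuous_fderiv one_ne_zero).clm_apply continuous_const
  have hcont : Continuous fun u : ℂ => Mfun W q (t • eJ d N p + u • eJbar d N q) :=
    hM.comp (by fun_prop)
  have hzero : Set.EqOn (fun u : ℂ => Mfun W q (t • eJ d N p + u • eJbar d N q)) (fun _ => 0)
      {0}ᶜ := by
    intro u hu
    have h := hward (q i) (q i) (t • eJ d N p + u • eJbar d N q)
    rw [Finset.sum_eq_single_of_mem q (by simp)] at h
    · have hne : q ≠ p := fun h => hpq (by rw [h])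
      simpa [eJ, eJbar, hne, Set.mem_compl_singleton_iff.mp hu] using h
    · intro r hr hrq
      obtain hri : r i = q i := by simpa using hr
      have hne : r ≠ p := fun h => hpq (by rw [← h, hri])
      have hupd : Function.update r i (q i) = r := by rw [← hri, Function.update_eq_self]
      simp [eJ, eJbar, hrq, hupd, hne]
  simpa using congrFun (hcont.ext_on (dense_compl_singleton 0) continuous_const hzero) 0

/-- Mixed partial derivatives of a twice continuously differentiable `W` commute. -/
theorem G11_eq_fderiv_Mfun {d N : ℕ} {W : Src d N → ℂ} (hW : ContDiff ℂ 2 W) (p q : Idx d N)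
    (x : Src d N) : G11 W p q x = fderiv ℂ (Mfun W q) x (eJ d N p) := by
  have hd : DifferentiableAt ℂ (fderiv ℂ W) x :=
    (hW.fderiv_right (m := 1) (by norm_num)).differentiable one_ne_zero x
  have hsymm : IsSymmSndFDerivAt ℂ W x :=
    hW.contDiffAt.isSymmSndFDerivAt (by simp)
  unfold G11 Mfun
  rw [fderiv_clm_apply hd (differentiableAt_const _),
    fderiv_clm_apply hd (differentiableAt_const _)]
  simpa using hsymm (eJbar d N q) (eJ d N p)

/-- if the first-order Ward–Takahashi identity holds in every slot,
then the two-point function is diagonal at `(J, J̄) = (0, 0)`. -/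
theorem two_point_diagonal_of_ward
    (d N : ℕ) (hd : 1 ≤ d) (hN : 1 ≤ N)
    (W : Src d N → ℂ) (hW : AnalyticOnNhd ℂ W Set.univ)
    (hward : ∀ i : Fin d, WardId W i) :
    ∀ p q : Idx d N, p ≠ q → G11 W p q (0, 0) = 0 := by
  intro p q hpq
  obtain ⟨i, hi⟩ := Function.ne_iff.mp hpq
  have hC : ContDiff ℂ 2 W := contDiffOn_univ.mp hW.contDiffOn_of_completeSpace
  rw [G11_eq_fderiv_Mfun hC]
  have hM : DifferentiableAt ℂ (Mfun W q) (0, 0) :=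
    ((hC.fderiv_right (m := 1) (by norm_num)).differentiable one_ne_zero _).clm_apply
      (differentiableAt_const _)
  rw [← hM.lineDeriv_eq_fderiv, lineDeriv]
  have hline (t : ℂ) : Mfun W q ((0, 0) + t • eJ d N p) = 0 := by
    rw [Prod.mk_zero_zero, zero_add]
    exact Mfun_smul_eJ_eq_zero (hC.of_le (by norm_num)) (hward i) hi t
  simp [hline]
end

section
/- Let W(J, J̄) be an entire function of the pair of tensor variables as in the context, and fix a slot i ∈ Fin d. Suppose the first-order Ward–Takahashi identity holds in slot i (for all a, b ∈ Fin N, identically in (J, J̄)). Then for all q, q' ∈ (Fin N)^d and all (J, J̄): Σ_{p, p' : p_j = p'_j for all j ≠ i} ( G^{(2,0)}(p,q) · J_{q'} · J_{p'} − G^{(1,1)}(q,p') · J_{q'} · J̄_p ) = − Σ_{p, p' : p_j = p'_j for all j ≠ i} δ_{p', q} · J_{q'} · M̄_p. -/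
open scoped BigOperators

theorem sum_agree_off_eq_sum_update {ι α M : Type*} [Fintype ι] [DecidableEq ι] [Fintype α]
    [DecidableEq α] [AddCommMonoid M] (i : ι)
    [DecidablePred fun pp : (ι → α) × (ι → α) => ∀ j : ι, j ≠ i → pp.1 j = pp.2 j]
    (f : (ι → α) × (ι → α) → M) :
    ∑ pp ∈ Finset.univ.filter
        (fun pp : (ι → α) × (ι → α) => ∀ j : ι, j ≠ i → pp.1 j = pp.2 j), f pp
      = ∑ b : α, ∑ p : ι → α, f (p, Function.update p i b) := by
  rw [← Fintype.sum_prod_type' (fun b p => f (p, Function.update p i b))]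
  refine Finset.sum_bij' (fun pp _ => (pp.2 i, pp.1))
    (fun bp _ => (bp.2, Function.update bp.2 i bp.1)) ?_ ?_ ?_ ?_ ?_
  · simp
  · intro bp _
    simp only [Finset.mem_filter, Finset.mem_univ, true_and]
    intro j hj
    simp [hj]
  · rintro ⟨p, p'⟩ h
    simp only [Finset.mem_filter, Finset.mem_univ, true_and] at h
    simpa [Function.update_eq_iff] using h
  · simp
  · rintro ⟨p, p'⟩ h
    simp only [Finset.mem_filter, Finset.mem_univ, true_and] at h
    have : Function.update p i (p' i) = p' := by simpa [Function.update_eq_iff] using h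
    simp [this]

/-- Summing the Ward identity over all pairs of values in slot `i`. -/
theorem WardId.sum_agree_off_eq_zero {d N : ℕ} {W : Src d N → ℂ} {i : Fin d}
    (hward : WardId W i) (x : Src d N) :
    ∑ pp ∈ Finset.univ.filter
        (fun pp : Idx d N × Idx d N => ∀ j : Fin d, j ≠ i → pp.1 j = pp.2 j),
      (x.2 pp.1 * Mfun W pp.2 x - Mbarfun W pp.1 x * x.1 pp.2) = 0 := by
  rw [sum_agree_off_eq_sum_update i]
  refine Finset.sum_eq_zero fun b _ => ?_
  rw [← Finset.sum_fiberwise Finset.univ (fun p : Idx d N => p i)]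
  exact Finset.sum_eq_zero fun a _ => hward a b x

theorem hasFDerivAt_fderiv_apply {E : Type*} [NormedAddCommGroup E] [NormedSpace ℂ E]
    {W : E → ℂ} {x : E} (hW : AnalyticAt ℂ W x) (v : E) :
    HasFDerivAt (fun y => fderiv ℂ W y v) ((fderiv ℂ (fderiv ℂ W) x).flip v) x := by
  simpa using hW.fderiv.differentiableAt.hasFDerivAt.clm_apply (hasFDerivAt_const v x)

theorem fderiv_fderiv_apply_comm {E : Type*} [NormedAddCommGroup E] [NormedSpace ℂ E]
    {W : E → ℂ} {x : E} (hW : AnalyticAt ℂ W x) (v w : E) :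
    fderiv ℂ (fun y => fderiv ℂ W y v) x w = fderiv ℂ (fun y => fderiv ℂ W y w) x v := by
  rw [(hasFDerivAt_fderiv_apply hW v).fderiv, (hasFDerivAt_fderiv_apply hW w).fderiv]
  exact (hW.contDiffAt (n := minSmoothness ℂ 2)).isSymmSndFDerivAt le_rfl w v

/-- The `J_q`-derivative of one summand of the Ward identity. -/
theorem fderiv_ward_summand {d N : ℕ} {W : Src d N → ℂ} {x : Src d N}
    (hW : AnalyticAt ℂ W x) (p p' q : Idx d N) :
    DifferentiableAt ℂ (fun y : Src d N => y.2 p * Mfun W p' y - Mbarfun W p y * y.1 p') x ∧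
    fderiv ℂ (fun y : Src d N => y.2 p * Mfun W p' y - Mbarfun W p y * y.1 p') x (eJ d N q)
      = x.2 p * G11 W q p' x
        - (G20 W p q x * x.1 p' + (if p' = q then (1 : ℂ) else 0) * Mbarfun W p x) := by
  have hM : HasFDerivAt (Mfun W p') (fderiv ℂ (Mfun W p') x) x :=
    (hasFDerivAt_fderiv_apply hW (eJbar d N p')).differentiableAt.hasFDerivAt
  have hMbar : HasFDerivAt (Mbarfun W p) (fderiv ℂ (Mbarfun W p) x) x :=
    (hasFDerivAt_fderiv_apply hW (eJ d N p)).differentiableAt.hasFDerivAt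
  have hJ : HasFDerivAt (fun y : Src d N => y.1 p')
      ((ContinuousLinearMap.proj p').comp (ContinuousLinearMap.fst ℂ (Tensor d N) (Tensor d N)))
      x := ((ContinuousLinearMap.proj (R := ℂ) (φ := fun _ : Idx d N => ℂ) p').comp
        (ContinuousLinearMap.fst ℂ (Tensor d N) (Tensor d N))).hasFDerivAt
  have hJbar : HasFDerivAt (fun y : Src d N => y.2 p)
      ((ContinuousLinearMap.proj p).comp (ContinuousLinearMap.snd ℂ (Tensor d N) (Tensor d N)))
      x := ((ContinuousLinearMap.proj (R := ℂ) (φ := fun _ : Idx d N => ℂ) p).comp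
        (ContinuousLinearMap.snd ℂ (Tensor d N) (Tensor d N))).hasFDerivAt
  have hG11 : fderiv ℂ (Mfun W p') x (eJ d N q) = G11 W q p' x :=
    fderiv_fderiv_apply_comm hW _ _
  have hG20 : fderiv ℂ (Mbarfun W p) x (eJ d N q) = G20 W p q x := rfl
  have h := (hJbar.mul hM).sub (hMbar.mul hJ)
  refine ⟨h.differentiableAt, (DFunLike.congr_fun h.fderiv _).trans ?_⟩
  simp only [sub_apply, add_apply,
    smul_apply, hG11, hG20, smul_eq_mul]
  simp [eJ, Pi.single_apply]
  ring

/-- consequence of the first-order Ward–Takahashi identity in slot `i`,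
obtained by differentiating it with respect to `J` and multiplying by `J_{q'}`. -/
theorem ward_derivative_J_identity
    (d N : ℕ) (hd : 1 ≤ d) (hN : 1 ≤ N)
    (W : Src d N → ℂ) (hW : AnalyticOnNhd ℂ W Set.univ)
    (i : Fin d) (hward : WardId W i) :
    ∀ q q' : Idx d N, ∀ x : Src d N,
      ∑ pp ∈ Finset.univ.filter
          (fun pp : Idx d N × Idx d N => ∀ j : Fin d, j ≠ i → pp.1 j = pp.2 j),
        (G20 W pp.1 q x * x.1 q' * x.1 pp.2
          - G11 W q pp.2 x * x.1 q' * x.2 pp.1)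
      = - ∑ pp ∈ Finset.univ.filter
            (fun pp : Idx d N × Idx d N => ∀ j : Fin d, j ≠ i → pp.1 j = pp.2 j),
          (if pp.2 = q then (1 : ℂ) else 0) * x.1 q' * Mbarfun W pp.1 x := by
  intro q q' x
  have hx : AnalyticAt ℂ W x := hW x (Set.mem_univ x)
  have hzero := DFunLike.congr_fun
    (congrArg (fun F => fderiv ℂ F x) (funext hward.sum_agree_off_eq_zero)) (eJ d N q)
  rw [fderiv_fun_sum fun pp _ => (fderiv_ward_summand hx pp.1 pp.2 q).1] at hzero
  simp only [sum_apply, (fderiv_ward_summand hx _ _ q).2,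
    fderiv_fun_const, Pi.zero_apply, zero_apply] at hzero
  rw [eq_neg_iff_add_eq_zero, ← Finset.sum_add_distrib]
  refine Eq.trans ?_ ((congrArg (-x.1 q' * ·) hzero).trans (mul_zero _))
  rw [Finset.mul_sum]
  exact Finset.sum_congr rfl fun pp _ => by ring
end

section
/- Let W(J, J̄) be an entire function of the pair of tensor variables as in the context, and fix a slot i ∈ Fin d. Suppose the first-order Ward–Takahashi identity holds in slot i (for all a, b ∈ Fin N, identically in (J, J̄)). Then for all q, q' ∈ (Fin N)^d and all (J, J̄): Σ_{p, p' : p_j = p'_j for all j ≠ i} ( G^{(0,2)}(p',q') · J̄_p · J̄_q − G^{(1,1)}(p,q') · J_{p'} · J̄_q ) = − Σ_{p, p' : p_j = p'_j for all j ≠ i} δ_{q', p} · J̄_q · M_{p'}. -/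
open scoped BigOperators

/-- Pairs of multi-indices agreeing off slot `i` are the pairs `(p, p[i ↦ b])`. -/
theorem sum_agree_off_slot {d N : ℕ} {A : Type*} [AddCommMonoid A] (i : Fin d)
    (f : Idx d N → Idx d N → A) :
    ∑ pp ∈ Finset.univ.filter
        (fun pp : Idx d N × Idx d N => ∀ j : Fin d, j ≠ i → pp.1 j = pp.2 j), f pp.1 pp.2
      = ∑ p : Idx d N, ∑ b : Fin N, f p (Function.update p i b) := by
  rw [← Fintype.sum_prod_type']
  symm
  refine Finset.sum_bij' (fun x _ => (x.1, Function.update x.1 i x.2))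
    (fun pp _ => (pp.1, pp.2 i)) ?_ ?_ ?_ ?_ ?_
  · rintro ⟨p, b⟩ -
    simp only [Finset.mem_filter, Finset.mem_univ, true_and]
    intro j hj
    rw [Function.update_of_ne hj]
  · simp
  · simp
  · rintro ⟨p, p'⟩ h
    simp only [Finset.mem_filter, Finset.mem_univ, true_and] at h
    refine Prod.ext rfl (funext fun j => ?_)
    by_cases hj : j = i
    · subst hj; simp
    · simp [Function.update_of_ne hj, h j hj]
  · simp

/-- The Ward identity summed over both colour entries. -/
theorem WardId.sum_agree_off_slot_eq_zero {d N : ℕ} {W : Src d N → ℂ} {i : Fin d}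
    (h : WardId W i) (x : Src d N) :
    ∑ pp ∈ Finset.univ.filter
        (fun pp : Idx d N × Idx d N => ∀ j : Fin d, j ≠ i → pp.1 j = pp.2 j),
      (x.2 pp.1 * Mfun W pp.2 x - Mbarfun W pp.1 x * x.1 pp.2) = 0 := by
  rw [sum_agree_off_slot i (fun p p' => x.2 p * Mfun W p' x - Mbarfun W p x * x.1 p'),
    Finset.sum_comm]
  refine Finset.sum_eq_zero fun b _ => ?_
  rw [← Finset.sum_fiberwise Finset.univ (fun p : Idx d N => p i)]
  exact Finset.sum_eq_zero fun a _ => h a b x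

/-- The `J̄_{q'}`-derivative of one term of the Ward identity. -/
theorem fderiv_ward_term {d N : ℕ} {W : Src d N → ℂ} (hW : AnalyticOnNhd ℂ W Set.univ)
    (p p' q' : Idx d N) (x : Src d N) :
    DifferentiableAt ℂ (fun y : Src d N => y.2 p * Mfun W p' y - Mbarfun W p y * y.1 p') x ∧
    fderiv ℂ (fun y : Src d N => y.2 p * Mfun W p' y - Mbarfun W p y * y.1 p') x (eJbar d N q')
      = (if q' = p then (1 : ℂ) else 0) * Mfun W p' x + G02 W p' q' x * x.2 p
        - G11 W p q' x * x.1 p' := by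
  have hd : DifferentiableAt ℂ (fderiv ℂ W) x := (hW.fderiv x (Set.mem_univ x)).differentiableAt
  have hM : HasFDerivAt (Mfun W p') (fderiv ℂ (Mfun W p') x) x :=
    (hd.clm_apply (differentiableAt_const (eJbar d N p'))).hasFDerivAt
  have hMbar : HasFDerivAt (Mbarfun W p) (fderiv ℂ (Mbarfun W p) x) x :=
    (hd.clm_apply (differentiableAt_const (eJ d N p))).hasFDerivAt
  have h1 : HasFDerivAt (fun y : Src d N => y.1 p') _ x :=
    ((ContinuousLinearMap.proj (R := ℂ) (φ := fun _ : Idx d N => ℂ) p').comp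
      (ContinuousLinearMap.fst ℂ (Tensor d N) (Tensor d N))).hasFDerivAt
  have h2 : HasFDerivAt (fun y : Src d N => y.2 p) _ x :=
    ((ContinuousLinearMap.proj (R := ℂ) (φ := fun _ : Idx d N => ℂ) p).comp
      (ContinuousLinearMap.snd ℂ (Tensor d N) (Tensor d N))).hasFDerivAt
  have key := (h2.mul hM).sub (hMbar.mul h1)
  refine ⟨key.differentiableAt, ?_⟩
  have hG02 : fderiv ℂ (Mfun W p') x (eJbar d N q') = G02 W p' q' x := rfl
  have hG11 : fderiv ℂ (Mbarfun W p) x (eJbar d N q') = G11 W p q' x := rfl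
  have e1 : (eJbar d N q').1 p' = 0 := rfl
  have e2 : (eJbar d N q').2 p = if q' = p then (1 : ℂ) else 0 := by
    simp [eJbar, Pi.single_apply, eq_comm]
  refine (congrArg (fun L => L (eJbar d N q')) key.fderiv).trans ?_
  simp only [sub_apply, add_apply,
    smul_apply, ContinuousLinearMap.comp_apply,
    ContinuousLinearMap.proj_apply, ContinuousLinearMap.coe_fst', ContinuousLinearMap.coe_snd',
    smul_eq_mul, hG02, hG11, e1, e2]
  ring

/-- consequence of the first-order Ward–Takahashi identity in slot `i`,
obtained by differentiating it with respect to `J̄` and multiplying by `J̄_q`. -/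
theorem ward_derivative_Jbar_identity
    (d N : ℕ) (hd : 1 ≤ d) (hN : 1 ≤ N)
    (W : Src d N → ℂ) (hW : AnalyticOnNhd ℂ W Set.univ)
    (i : Fin d) (hward : WardId W i) :
    ∀ q q' : Idx d N, ∀ x : Src d N,
      ∑ pp ∈ Finset.univ.filter
          (fun pp : Idx d N × Idx d N => ∀ j : Fin d, j ≠ i → pp.1 j = pp.2 j),
        (G02 W pp.2 q' x * x.2 pp.1 * x.2 q
          - G11 W pp.1 q' x * x.1 pp.2 * x.2 q)
      = - ∑ pp ∈ Finset.univ.filter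
            (fun pp : Idx d N × Idx d N => ∀ j : Fin d, j ≠ i → pp.1 j = pp.2 j),
          (if q' = pp.1 then (1 : ℂ) else 0) * x.2 q * Mfun W pp.2 x := by
  intro q q' x
  have hzero := congrArg (fun F : Src d N → ℂ => fderiv ℂ F x (eJbar d N q'))
    (funext hward.sum_agree_off_slot_eq_zero)
  rw [fderiv_fun_sum fun pp _ => (fderiv_ward_term hW pp.1 pp.2 q' x).1,
    sum_apply,
    Finset.sum_congr rfl fun pp _ => (fderiv_ward_term hW pp.1 pp.2 q' x).2] at hzero
  simp only [fderiv_fun_const, Pi.zero_apply, zero_apply] at hzero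
  replace hzero := congrArg (x.2 q * ·) hzero
  simp only [mul_zero, Finset.mul_sum] at hzero
  rw [eq_neg_iff_add_eq_zero, ← Finset.sum_add_distrib]
  refine (Finset.sum_congr rfl fun pp _ => ?_).trans hzero
  ring
end

section
/- (No Ward–Takahashi identity violation at second order.) Let W(J, J̄) be an entire function of the pair of tensor variables as in the context. Fix slots i, j ∈ Fin d (possibly equal), and suppose the first-order Ward–Takahashi identities hold in slot i and in slot j (each for all a, b ∈ Fin N, identically in (J, J̄)). Then the second-order Ward quantity I_{ij} vanishes identically: for all (J, J̄), Σ_{p, p', q, q' : p_l = p'_l for all l ≠ i, and q_l = q'_l for all l ≠ j} [ J̄_p J̄_q G^{(0,2)}(q',p') + M_{p'} M_{q'} J̄_p J̄_q − J̄_p J_{q'} G^{(1,1)}(q,p') − J̄_p J_{q'} M̄_q M_{p'} − J_{p'} J̄_q G^{(1,1)}(p,q') − M̄_p M_{q'} J_{p'} J̄_q + J_{p'} J_{q'} G^{(2,0)}(p,q) + J_{p'} J_{q'} M̄_p M̄_q + δ_{p',q} J_{q'} M̄_p + δ_{p,q'} J̄_q M_{p'} ] = 0. In particular I_{12} = I_{11}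 = I_{22} = 0, so the second-order terms of the variation of the generating functional provide no additional constraint on the correlation functions. -/
open scoped BigOperators

/-- The pairs of multi-indices that agree outside slot `i`. -/
def slotPairs (d N : ℕ) (i : Fin d) : Finset (Idx d N × Idx d N) :=
  Finset.univ.filter fun t => ∀ l : Fin d, l ≠ i → t.1 l = t.2 l

theorem sum_slotPairs {d N : ℕ} {A : Type*} [AddCommMonoid A] (i : Fin d)
    (f : Idx d N → Idx d N → A) :
    ∑ t ∈ slotPairs d N i, f t.1 t.2 =
      ∑ b : Fin N, ∑ a : Fin N, ∑ p ∈ Finset.univ.filter (fun p : Idx d N => p i = a),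
        f p (Function.update p i b) := by
  simp_rw [Finset.sum_fiberwise]
  rw [← Finset.sum_product']
  refine Finset.sum_nbij' (fun t => (t.2 i, t.1)) (fun s => (s.2, Function.update s.2 i s.1))
    ?_ ?_ ?_ ?_ ?_
  · simp
  · rintro ⟨b, p⟩ -
    simp +contextual [slotPairs, Function.update_of_ne]
  · rintro ⟨p, p'⟩ h
    simp only [slotPairs, Finset.mem_filter, Finset.mem_univ, true_and] at h
    exact Prod.ext rfl (Function.update_eq_iff.2 ⟨rfl, h⟩)
  · simp
  · rintro ⟨p, p'⟩ h
    simp only [slotPairs, Finset.mem_filter, Finset.mem_univ, true_and] at h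
    rw [Function.update_eq_iff.2 ⟨rfl, h⟩]

theorem WardId.sum_slotPairs_eq_zero {d N : ℕ} {W : Src d N → ℂ} {i : Fin d}
    (h : WardId W i) (x : Src d N) :
    ∑ t ∈ slotPairs d N i, (x.2 t.1 * Mfun W t.2 x - Mbarfun W t.1 x * x.1 t.2) = 0 := by
  rw [sum_slotPairs i fun p p' => x.2 p * Mfun W p' x - Mbarfun W p x * x.1 p']
  exact Finset.sum_eq_zero fun b _ => Finset.sum_eq_zero fun a _ => h a b x

theorem fderiv_fderiv_apply {E F : Type*} [NormedAddCommGroup E] [NormedSpace ℂ E]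
    [NormedAddCommGroup F] [NormedSpace ℂ F] {W : E → F} {x : E}
    (h : DifferentiableAt ℂ (fderiv ℂ W) x) (u v : E) :
    fderiv ℂ (fun y => fderiv ℂ W y u) x v = fderiv ℂ (fderiv ℂ W) x v u := by
  rw [fderiv_clm_apply h (differentiableAt_const u)]
  simp

/-- The derivative of the first-order Ward–Takahashi identity in direction `v`. -/
theorem WardId.sum_fderiv_eq_zero {d N : ℕ} {W : Src d N → ℂ} {i : Fin d}
    (h : WardId W i) {x : Src d N} (hW : DifferentiableAt ℂ (fderiv ℂ W) x) (v : Src d N) :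
    ∑ t ∈ slotPairs d N i,
      (v.2 t.1 * Mfun W t.2 x + x.2 t.1 * fderiv ℂ (fderiv ℂ W) x v (eJbar d N t.2)
        - fderiv ℂ (fderiv ℂ W) x v (eJ d N t.1) * x.1 t.2 - Mbarfun W t.1 x * v.1 t.2) = 0 := by
  have hW' (u : Src d N) : HasFDerivAt (fun y => fderiv ℂ W y u)
      ((fderiv ℂ (fderiv ℂ W) x).flip u) x := by
    simpa using hW.hasFDerivAt.clm_apply (hasFDerivAt_const u x)
  have h₁ (p : Idx d N) : HasFDerivAt (fun y : Src d N => y.1 p) _ x :=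
    ((ContinuousLinearMap.proj (R := ℂ) (φ := fun _ : Idx d N => ℂ) p).comp
      (ContinuousLinearMap.fst ℂ (Tensor d N) (Tensor d N))).hasFDerivAt
  have h₂ (p : Idx d N) : HasFDerivAt (fun y : Src d N => y.2 p) _ x :=
    ((ContinuousLinearMap.proj (R := ℂ) (φ := fun _ : Idx d N => ℂ) p).comp
      (ContinuousLinearMap.snd ℂ (Tensor d N) (Tensor d N))).hasFDerivAt
  have hsum := HasFDerivAt.fun_sum (u := slotPairs d N i) fun t _ =>
    ((h₂ t.1).mul (hW' (eJbar d N t.2))).sub ((hW' (eJ d N t.1)).mul (h₁ t.2))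
  have hzero := hsum.unique
    ((hasFDerivAt_const (0 : ℂ) x).congr_of_eventuallyEq
      (Filter.Eventually.of_forall h.sum_slotPairs_eq_zero))
  have happ := congrArg (fun L : Src d N →L[ℂ] ℂ => L v) hzero
  simp only [sum_apply] at happ
  refine Eq.trans (Finset.sum_congr rfl fun t _ => ?_) happ
  simp [Mfun, Mbarfun]
  ring

/-- No Ward–Takahashi identity violation at second order: if the
first-order Ward–Takahashi identities hold in slots `i` and `j`, then the
second-order Ward quantity `I_{ij}` vanishes identically. -/
theorem second_order_ward_identity_vanishes
    (d N : ℕ) (hd : 1 ≤ d) (hN : 1 ≤ N)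
    (W : Src d N → ℂ) (hW : AnalyticOnNhd ℂ W Set.univ)
    (i j : Fin d) (hwi : WardId W i) (hwj : WardId W j) :
    ∀ x : Src d N,
      ∑ t ∈ Finset.univ.filter
          (fun t : (Idx d N × Idx d N) × (Idx d N × Idx d N) =>
            (∀ l : Fin d, l ≠ i → t.1.1 l = t.1.2 l) ∧
            (∀ l : Fin d, l ≠ j → t.2.1 l = t.2.2 l)),
        (x.2 t.1.1 * x.2 t.2.1 * G02 W t.2.2 t.1.2 x
          + Mfun W t.1.2 x * Mfun W t.2.2 x * x.2 t.1.1 * x.2 t.2.1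
          - x.2 t.1.1 * x.1 t.2.2 * G11 W t.2.1 t.1.2 x
          - x.2 t.1.1 * x.1 t.2.2 * Mbarfun W t.2.1 x * Mfun W t.1.2 x
          - x.1 t.1.2 * x.2 t.2.1 * G11 W t.1.1 t.2.2 x
          - Mbarfun W t.1.1 x * Mfun W t.2.2 x * x.1 t.1.2 * x.2 t.2.1
          + x.1 t.1.2 * x.1 t.2.2 * G20 W t.1.1 t.2.1 x
          + x.1 t.1.2 * x.1 t.2.2 * Mbarfun W t.1.1 x * Mbarfun W t.2.1 x
          + (if t.1.2 = t.2.1 then (1 : ℂ) else 0) * x.1 t.2.2 * Mbarfun W t.1.1 x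
          + (if t.1.1 = t.2.2 then (1 : ℂ) else 0) * x.2 t.2.1 * Mfun W t.1.2 x)
        = 0 := by
  intro x
  have hD : DifferentiableAt ℂ (fderiv ℂ W) x := (hW.fderiv x trivial).differentiableAt
  have hsymm (u v : Src d N) :
      fderiv ℂ (fderiv ℂ W) x u v = fderiv ℂ (fderiv ℂ W) x v u :=
    ((hW x trivial).contDiffAt (n := 2)).isSymmSndFDerivAt (by simp) u v
  have hprod : Finset.univ.filter
      (fun t : (Idx d N × Idx d N) × (Idx d N × Idx d N) =>
        (∀ l : Fin d, l ≠ i → t.1.1 l = t.1.2 l) ∧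
        (∀ l : Fin d, l ≠ j → t.2.1 l = t.2.2 l)) = slotPairs d N i ×ˢ slotPairs d N j := by
    ext t
    simp [slotPairs]
  rw [hprod, Finset.sum_product_right]
  refine Finset.sum_eq_zero fun u _ => ?_
  have h₀ := congrArg (· * (x.2 u.1 * Mfun W u.2 x - Mbarfun W u.1 x * x.1 u.2))
    (hwi.sum_slotPairs_eq_zero x)
  have h₁ := congrArg (x.2 u.1 * ·) (hwi.sum_fderiv_eq_zero hD (eJbar d N u.2))
  have h₂ := congrArg (x.1 u.2 * ·) (hwi.sum_fderiv_eq_zero hD (eJ d N u.1))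
  simp only [Finset.sum_mul, Finset.mul_sum, zero_mul, mul_zero] at h₀ h₁ h₂
  have h := congrArg₂ (· + ·) h₀ (congrArg₂ (· - ·) h₁ h₂)
  simp only [← Finset.sum_sub_distrib, ← Finset.sum_add_distrib, sub_zero, add_zero] at h
  refine Eq.trans (Finset.sum_congr rfl fun t _ => ?_) h
  simp only [G02, G11, G20, fderiv_fderiv_apply hD]
  rw [hsymm (eJbar d N t.2) (eJbar d N u.2), hsymm (eJbar d N t.2) (eJ d N u.1)]
  have hJ (p q : Idx d N) : (eJ d N p).1 q = if q = p then 1 else 0 := Pi.single_apply p 1 q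
  have hJbar (p q : Idx d N) : (eJbar d N p).2 q = if q = p then 1 else 0 := Pi.single_apply p 1 q
  have hJ' (p q : Idx d N) : (eJ d N p).2 q = 0 := rfl
  have hJbar' (p q : Idx d N) : (eJbar d N p).1 q = 0 := rfl
  simp only [hJ, hJbar, hJ', hJbar']
  ring
end

section
/- (Existence of the UV non-Gaussian fixed point FP1.) Define, for real m̄² with 1 + m̄² > 0 and real λ̄: η(m̄², λ̄) := (24π²λ̄/(5√5)) · [ (1 + m̄²)² − (π²√5 λ̄/6)(2 + m̄²) ] / [ (1 + m̄²)⁴ − (6π²λ̄/(5√5))(1 + m̄²)² + (π⁴λ̄²/15)(2 + m̄²) ], β_m(m̄², λ̄) := −(2 + η)·m̄² − (12π²/√5)·λ̄·(1 + η/6)/(1 + m̄²)², β_λ(m̄², λ̄) := −2ηλ̄ + (4π²λ̄²/√5)·((1 + η/6)/(1 + m̄²)³)·[ 1 − (π²λ̄/√5)·( 1/(1 + m̄²)² + 1 + 1/(1 + m̄²) ) ]. Then there exists a point (m̄²*, λ̄*) with m̄²* ∈ (−0.65, −0.60) and λ̄* ∈ (0.003, 0.005) at which the denominator of η is nonzero,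 β_m(m̄²*, λ̄*) = 0, β_λ(m̄²*, λ̄*) = 0, and η(m̄²*, λ̄*) ∈ (0.5, 0.7). -/
open Real

/-- Denominator of the anomalous dimension `η(m̄², λ̄)`. -/
noncomputable def etaDenom (m lam : ℝ) : ℝ :=
  (1 + m) ^ 4 - (6 * π ^ 2 * lam / (5 * Real.sqrt 5)) * (1 + m) ^ 2
    + (π ^ 4 * lam ^ 2 / 15) * (2 + m)

/-- Anomalous dimension `η(m̄², λ̄)` of the rank-6 Abelian quartic melonic model
with closure constraint, from the effective vertex expansion. -/
noncomputable def eta (m lam : ℝ) : ℝ :=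
  (24 * π ^ 2 * lam / (5 * Real.sqrt 5)) *
      ((1 + m) ^ 2 - (π ^ 2 * Real.sqrt 5 * lam / 6) * (2 + m)) / etaDenom m lam

/-- Beta function `β_{m²}(m̄², λ̄)` of the dimensionless mass. -/
noncomputable def betaM (m lam : ℝ) : ℝ :=
  -(2 + eta m lam) * m
    - (12 * π ^ 2 / Real.sqrt 5) * lam * (1 + eta m lam / 6) / (1 + m) ^ 2

/-- Beta function `β_{λ₄}(m̄², λ̄)` of the dimensionless quartic coupling. -/
noncomputable def betaLam (m lam : ℝ) : ℝ :=
  -2 * eta m lam * lam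
    + (4 * π ^ 2 * lam ^ 2 / Real.sqrt 5) * ((1 + eta m lam / 6) / (1 + m) ^ 3) *
        (1 - (π ^ 2 * lam / Real.sqrt 5) * (1 / (1 + m) ^ 2 + 1 + 1 / (1 + m)))

/-- Numerator of `η` at `m̄² = x - 1`, `π² λ̄ / √5 = y x²`. -/
noncomputable def etaNum (x y : ℝ) : ℝ := 24 * y * (1 - 5 / 6 * y * (1 + x))

/-- Denominator of `η` at `m̄² = x - 1`, `π² λ̄ / √5 = y x²`. -/
noncomputable def etaDen (x y : ℝ) : ℝ := 5 * (1 - 6 / 5 * y + y ^ 2 * (1 + x) / 3)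

/-- The coupling `λ̄` with `π² λ̄ / √5 = y x²`. -/
noncomputable def coupling (x y : ℝ) : ℝ := Real.sqrt 5 * (y * x ^ 2) / π ^ 2

lemma sqrt_five_sq : Real.sqrt 5 ^ 2 = 5 := Real.sq_sqrt (by norm_num)

lemma etaDenom_coupling (x y : ℝ) :
    etaDenom (x - 1) (coupling x y) = x ^ 4 * (etaDen x y / 5) := by
  have h5 : Real.sqrt 5 ≠ 0 := by positivity
  have hπ := Real.pi_ne_zero
  unfold etaDenom coupling etaDen
  field_simp
  rw [sqrt_five_sq]
  ring

lemma eta_coupling {x y : ℝ} (hx : x ≠ 0) :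
    eta (x - 1) (coupling x y) = etaNum x y / etaDen x y := by
  have h5 : Real.sqrt 5 ≠ 0 := by positivity
  have hπ := Real.pi_ne_zero
  have hnum : 24 * π ^ 2 * coupling x y / (5 * Real.sqrt 5) *
      ((1 + (x - 1)) ^ 2 - (π ^ 2 * Real.sqrt 5 * coupling x y / 6) * (2 + (x - 1)))
        = x ^ 4 / 5 * etaNum x y := by
    unfold coupling etaNum
    field_simp
    rw [sqrt_five_sq]
    ring
  rw [eta, hnum, etaDenom_coupling,
    show x ^ 4 * (etaDen x y / 5) = x ^ 4 / 5 * etaDen x y by ring,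
    mul_div_mul_left _ _ (by positivity)]

lemma betaM_coupling {x y : ℝ} (hx : x ≠ 0) (hD : etaDen x y ≠ 0) :
    betaM (x - 1) (coupling x y) =
      ((1 - x) * (2 * etaDen x y + etaNum x y)
        - 2 * y * (6 * etaDen x y + etaNum x y)) / etaDen x y := by
  have h5 : Real.sqrt 5 ≠ 0 := by positivity
  have hπ := Real.pi_ne_zero
  rw [betaM, eta_coupling hx, coupling, add_sub_cancel]
  field_simp
  ring

lemma betaLam_coupling {x y : ℝ} (hx : x ≠ 0) (hD : etaDen x y ≠ 0) :
    betaLam (x - 1) (coupling x y) =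
      -(2 * coupling x y / (x * etaDen x y)) *
        (etaNum x y * x
          - 2 * y * (etaDen x y + etaNum x y / 6) * (1 - y * (1 + x + x ^ 2))) := by
  have h5 : Real.sqrt 5 ≠ 0 := by positivity
  have hπ := Real.pi_ne_zero
  rw [betaLam, eta_coupling hx, coupling, add_sub_cancel]
  field_simp
  ring

/-- Discriminant of the quadratic equation for `1 + x` expressing `β_m = 0` at fixed `y`. -/
noncomputable def massDiscr (y : ℝ) : ℝ :=
  (10 + 12 * y + 100 / 3 * y ^ 2 - 20 * y ^ 3) ^ 2
    - 4 * (50 / 3 * y ^ 2) * (20 - 36 * y + 24 * y ^ 2)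

/-- The solution branch `x = 1 + m̄²` of `β_m = 0` as a function of `y`. -/
noncomputable def massBranch (y : ℝ) : ℝ :=
  2 * (20 - 36 * y + 24 * y ^ 2) /
    (10 + 12 * y + 100 / 3 * y ^ 2 - 20 * y ^ 3 + Real.sqrt (massDiscr y)) - 1

/-- The factor of `β_λ` whose zero on the branch `massBranch` gives the fixed point. -/
noncomputable def branchGap (y : ℝ) : ℝ :=
  etaNum (massBranch y) y * massBranch y
    - 2 * y * (etaDen (massBranch y) y + etaNum (massBranch y) y / 6)
      * (1 - y * (1 + massBranch y + massBranch y ^ 2))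

lemma massBranch_denom_pos {y : ℝ} (h0 : 0 ≤ y) (h1 : y ≤ 1) :
    0 < 10 + 12 * y + 100 / 3 * y ^ 2 - 20 * y ^ 3 + Real.sqrt (massDiscr y) := by
  have := Real.sqrt_nonneg (massDiscr y)
  have : y ^ 3 ≤ y ^ 2 := pow_le_pow_of_le_one h0 h1 (by norm_num)
  nlinarith [sq_nonneg y]

lemma massBranch_spec {y : ℝ} (h0 : 0 ≤ y) (h1 : y ≤ 1) (hΔ : 0 ≤ massDiscr y) :
    (1 - massBranch y) * (2 * etaDen (massBranch y) y + etaNum (massBranch y) y)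
      - 2 * y * (6 * etaDen (massBranch y) y + etaNum (massBranch y) y) = 0 := by
  have hpos := massBranch_denom_pos h0 h1
  have hsq := Real.sq_sqrt hΔ
  have hx : (1 + massBranch y) * (10 + 12 * y + 100 / 3 * y ^ 2 - 20 * y ^ 3
      + Real.sqrt (massDiscr y)) = 2 * (20 - 36 * y + 24 * y ^ 2) := by
    rw [massBranch, add_sub_cancel, div_mul_cancel₀ _ hpos.ne']
  set x := massBranch y
  set r := Real.sqrt (massDiscr y)
  set b := 10 + 12 * y + 100 / 3 * y ^ 2 - 20 * y ^ 3 with hb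
  unfold massDiscr at hsq
  refine (mul_eq_zero_iff_right (pow_ne_zero 2 hpos.ne')).1 ?_
  have hquad : (1 - x) * (2 * etaDen x y + etaNum x y) - 2 * y * (6 * etaDen x y + etaNum x y)
      = 50 / 3 * y ^ 2 * (1 + x) ^ 2 - b * (1 + x) + (20 - 36 * y + 24 * y ^ 2) := by
    rw [hb, etaDen, etaNum]
    ring
  rw [hquad]
  linear_combination (50 / 3 * y ^ 2 * ((1 + x) * (b + r) + 2 * (20 - 36 * y + 24 * y ^ 2))
    - b * (b + r)) * hx + (20 - 36 * y + 24 * y ^ 2) * hsq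

lemma massBranch_mem_Icc {y a b : ℝ} (h0 : 0 ≤ y) (h1 : y ≤ 1) {l u : ℝ}
    (hl : l ≤ Real.sqrt (massDiscr y)) (hu : Real.sqrt (massDiscr y) ≤ u)
    (ha : 0 ≤ 1 + a) (hb : 0 ≤ 1 + b)
    (hau : (1 + a) * (10 + 12 * y + 100 / 3 * y ^ 2 - 20 * y ^ 3 + u)
      ≤ 2 * (20 - 36 * y + 24 * y ^ 2))
    (hbl : 2 * (20 - 36 * y + 24 * y ^ 2)
      ≤ (1 + b) * (10 + 12 * y + 100 / 3 * y ^ 2 - 20 * y ^ 3 + l)) :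
    massBranch y ∈ Set.Icc a b := by
  have hpos := massBranch_denom_pos h0 h1
  constructor
  · rw [massBranch, le_sub_iff_add_le, le_div_iff₀ hpos]
    nlinarith
  · rw [massBranch, sub_le_iff_le_add, div_le_iff₀ hpos]
    nlinarith

lemma continuousOn_branchGap : ContinuousOn branchGap (Set.Icc 0 1) := by
  have hx : ContinuousOn massBranch (Set.Icc 0 1) := by
    have hd : Continuous massDiscr := by unfold massDiscr; fun_prop
    unfold massBranch
    refine (ContinuousOn.div (by fun_prop) ?_ fun y hy =>
      (massBranch_denom_pos hy.1 hy.2).ne').sub continuousOn_const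
    fun_prop
  unfold branchGap etaNum etaDen
  fun_prop

lemma massBranch_bounds {y : ℝ} (hy : y ∈ Set.Icc (0.122 : ℝ) 0.125) :
    massBranch y ∈ Set.Icc (0.36 : ℝ) 0.39 := by
  obtain ⟨h1, h2⟩ := hy
  have hy2 : y ^ 2 ∈ Set.Icc (0.014884 : ℝ) 0.015625 := ⟨by nlinarith, by nlinarith⟩
  have hy3 : y ^ 3 ∈ Set.Icc (0.0018 : ℝ) 0.002 :=
    ⟨by nlinarith [hy2.1], by nlinarith [hy2.2]⟩
  obtain ⟨h3, h4⟩ := hy2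
  obtain ⟨h5, h6⟩ := hy3
  have hl : (11.1 : ℝ) ≤ Real.sqrt (massDiscr y) := by
    apply Real.le_sqrt_of_sq_le
    unfold massDiscr
    nlinarith
  have hu : Real.sqrt (massDiscr y) ≤ (11.35 : ℝ) := by
    rw [Real.sqrt_le_left (by norm_num)]
    unfold massDiscr
    nlinarith
  apply massBranch_mem_Icc (by linarith) (by linarith) hl hu <;> nlinarith

lemma branchGap_left : 0 < branchGap 0.122 := by
  have h : massBranch 0.122 ∈ Set.Icc (0.378 : ℝ) 0.379 := by
    have hl : (11.239 : ℝ) ≤ Real.sqrt (massDiscr 0.122) := by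
      apply Real.le_sqrt_of_sq_le
      norm_num [massDiscr]
    have hu : Real.sqrt (massDiscr 0.122) ≤ (11.24 : ℝ) := by
      rw [Real.sqrt_le_left (by norm_num)]
      norm_num [massDiscr]
    apply massBranch_mem_Icc (by norm_num) (by norm_num) hl hu <;> norm_num
  obtain ⟨h1, h2⟩ := h
  unfold branchGap etaNum etaDen
  set x := massBranch 0.122
  nlinarith [mul_nonneg (sub_nonneg.2 h1) (sub_nonneg.2 h2), pow_nonneg (sub_nonneg.2 h1) 3]

lemma branchGap_right : branchGap 0.125 < 0 := by
  have h : massBranch 0.125 ∈ Set.Icc (0.365 : ℝ) 0.366 := by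
    have hl : (11.27 : ℝ) ≤ Real.sqrt (massDiscr 0.125) := by
      apply Real.le_sqrt_of_sq_le
      norm_num [massDiscr]
    have hu : Real.sqrt (massDiscr 0.125) ≤ (11.271 : ℝ) := by
      rw [Real.sqrt_le_left (by norm_num)]
      norm_num [massDiscr]
    apply massBranch_mem_Icc (by norm_num) (by norm_num) hl hu <;> norm_num
  obtain ⟨h1, h2⟩ := h
  unfold branchGap etaNum etaDen
  set x := massBranch 0.125
  nlinarith [mul_nonneg (sub_nonneg.2 h1) (sub_nonneg.2 h2), pow_nonneg (sub_nonneg.2 h1) 3]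

lemma coupling_bounds {x y : ℝ} (hx : x ∈ Set.Icc (0.36 : ℝ) 0.39)
    (hy : y ∈ Set.Icc (0.122 : ℝ) 0.125) : coupling x y ∈ Set.Ioo (0.003 : ℝ) 0.005 := by
  obtain ⟨hx1, hx2⟩ := hx
  obtain ⟨hy1, hy2⟩ := hy
  have hk1 : (2.236 : ℝ) ≤ Real.sqrt 5 := Real.le_sqrt_of_sq_le (by norm_num)
  have hk2 : Real.sqrt 5 ≤ (2.237 : ℝ) := by
    rw [Real.sqrt_le_left (by norm_num)]; norm_num
  have hp1 := Real.pi_gt_d2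
  have hp2 := Real.pi_lt_d2
  have hx3 : (0.1296 : ℝ) ≤ x ^ 2 := by nlinarith
  have hx4 : x ^ 2 ≤ (0.1521 : ℝ) := by nlinarith
  have hz1 : (0.0158 : ℝ) ≤ y * x ^ 2 := by nlinarith
  have hz2 : y * x ^ 2 ≤ (0.0191 : ℝ) := by nlinarith
  constructor
  · rw [coupling, lt_div_iff₀ (by positivity)]
    nlinarith
  · rw [coupling, div_lt_iff₀ (by positivity)]
    nlinarith

/-- Existence of the UV non-Gaussian fixed point FP1: there is a
point with `m̄²* ∈ (−0.65, −0.60)`, `λ̄* ∈ (0.003, 0.005)`, nonzero `η`-denominator,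
vanishing beta functions, and anomalous dimension `η ∈ (0.5, 0.7)`. -/
theorem exists_FP1 :
    ∃ m lam : ℝ, m ∈ Set.Ioo (-0.65 : ℝ) (-0.60 : ℝ) ∧
      lam ∈ Set.Ioo (0.003 : ℝ) (0.005 : ℝ) ∧
      etaDenom m lam ≠ 0 ∧
      betaM m lam = 0 ∧ betaLam m lam = 0 ∧
      eta m lam ∈ Set.Ioo (0.5 : ℝ) (0.7 : ℝ) := by
  obtain ⟨y, hy, hgap⟩ : (0 : ℝ) ∈ branchGap '' Set.Icc 0.122 0.125 :=
    intermediate_value_Icc' (by norm_num)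
      (continuousOn_branchGap.mono (Set.Icc_subset_Icc (by norm_num) (by norm_num)))
      ⟨branchGap_right.le, branchGap_left.le⟩
  have hx := massBranch_bounds hy
  have hlam := coupling_bounds hx hy
  have hΔ : 0 ≤ massDiscr y := by
    obtain ⟨h1, h2⟩ := hy
    have h3 : y ^ 2 ≤ 0.015625 := by nlinarith
    have h4 : y ^ 3 ≤ 0.002 := by nlinarith
    unfold massDiscr
    nlinarith
  have hM := massBranch_spec (by linarith [hy.1]) (by linarith [hy.2]) hΔ
  unfold branchGap at hgap
  obtain ⟨x, hxdef⟩ : ∃ x, massBranch y = x := ⟨_, rfl⟩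
  rw [hxdef] at hx hlam hM hgap
  obtain ⟨hx1, hx2⟩ := hx
  obtain ⟨hy1, hy2⟩ := hy
  have hx0 : x ≠ 0 := by linarith
  have hys1 : 0.1659 ≤ y * (1 + x) := by nlinarith
  have hys2 : y * (1 + x) ≤ 0.1738 := by nlinarith
  have hN : etaNum x y ∈ Set.Icc (2.5 : ℝ) 2.6 := by
    unfold etaNum
    constructor <;> nlinarith
  have hD : etaDen x y ∈ Set.Icc (4.2 : ℝ) 4.4 := by
    have h1 : 0.02 ≤ y ^ 2 * (1 + x) := by nlinarith
    have h2 : y ^ 2 * (1 + x) ≤ 0.022 := by nlinarith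
    unfold etaDen
    constructor <;> linarith
  have hDpos : 0 < etaDen x y := by linarith [hD.1]
  refine ⟨x - 1, coupling x y, ⟨by linarith, by linarith⟩, hlam, ?_, ?_, ?_, ?_⟩
  · rw [etaDenom_coupling]
    positivity
  · rw [betaM_coupling hx0 hDpos.ne', hM, zero_div]
  · rw [betaLam_coupling hx0 hDpos.ne', hgap, mul_zero]
  · rw [eta_coupling hx0]
    constructor
    · rw [lt_div_iff₀ hDpos]
      linarith [hN.1, hD.2]
    · rw [div_lt_iff₀ hDpos]
      linarith [hN.2, hD.1]
end

section
/- (FP1 is a hyperbolic fixed point with one relevant and one irrelevant direction.) With η, β_m, β_λ defined as in the context, there exists a point (m̄²*, λ̄*) with m̄²* ∈ (−0.65, −0.60) and λ̄* ∈ (0.003, 0.005) such that β_m(m̄²*, λ̄*) = 0, β_λ(m̄²*, λ̄*) = 0, the map (m̄², λ̄) ↦ (β_m, β_λ) is differentiable in a neighbourhood of (m̄²*, λ̄*), and the determinant of its Jacobian matrix at (m̄²*, λ̄*) is strictly negative; consequently the Jacobian has two real eigenvalues of opposite signs (one relevant and one irrelevant direction, with critical exponents of opposite signs). -/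
open Real

/-- The anomalous dimension in terms of `u = 1 + m̄²` and `g = π² λ̄ / √5`. -/
noncomputable def scaledEta (u g : ℝ) : ℝ :=
  24 / 5 * g * (u ^ 2 - 5 / 6 * g * (1 + u)) /
    (u ^ 4 - 6 / 5 * g * u ^ 2 + g ^ 2 / 3 * (1 + u))

/-- The mass beta function in terms of `u = 1 + m̄²` and `g = π² λ̄ / √5`. -/
noncomputable def scaledBetaM (u g : ℝ) : ℝ :=
  (2 + scaledEta u g) * (1 - u) - 12 * g * (1 + scaledEta u g / 6) / u ^ 2

/-- The ratio `β_λ / λ̄` in terms of `u = 1 + m̄²` and `g = π² λ̄ / √5`. -/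
noncomputable def scaledBetaLam (u g : ℝ) : ℝ :=
  -2 * scaledEta u g
    + 4 * g * (1 + scaledEta u g / 6) / u ^ 3 * (1 - g * (1 / u ^ 2 + 1 + 1 / u))

lemma eta_eq_scaledEta (m lam : ℝ) :
    eta m lam = scaledEta (1 + m) (π ^ 2 / √5 * lam) := by
  have h5 : √5 ^ 2 = (5 : ℝ) := Real.sq_sqrt (by norm_num)
  have h0 : √5 ≠ 0 := by positivity
  have hg : π ^ 4 * lam ^ 2 / 15 = (π ^ 2 / √5 * lam) ^ 2 / 3 := by
    field_simp
    rw [h5]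
    ring
  have hg' : π ^ 2 * √5 * lam / 6 = 5 / 6 * (π ^ 2 / √5 * lam) := by
    field_simp
    rw [h5]
    ring
  rw [eta, etaDenom, scaledEta, hg, hg']
  congr 1
  · ring
  · ring

lemma betaM_eq_scaledBetaM (m lam : ℝ) :
    betaM m lam = scaledBetaM (1 + m) (π ^ 2 / √5 * lam) := by
  rw [betaM, scaledBetaM, eta_eq_scaledEta]
  ring

lemma betaLam_eq_scaledBetaLam (m lam : ℝ) :
    betaLam m lam = lam * scaledBetaLam (1 + m) (π ^ 2 / √5 * lam) := by
  rw [betaLam, scaledBetaLam, eta_eq_scaledEta]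
  ring

lemma scaledEta_mul_sq {u : ℝ} (hu : u ≠ 0) (s : ℝ) :
    scaledEta u (s * u ^ 2) =
      24 / 5 * s * (1 - 5 / 6 * s * (1 + u)) / (1 - 6 / 5 * s + s ^ 2 / 3 * (1 + u)) := by
  have hn : 24 / 5 * (s * u ^ 2) * (u ^ 2 - 5 / 6 * (s * u ^ 2) * (1 + u)) =
      u ^ 4 * (24 / 5 * s * (1 - 5 / 6 * s * (1 + u))) := by ring
  have hd : u ^ 4 - 6 / 5 * (s * u ^ 2) * u ^ 2 + (s * u ^ 2) ^ 2 / 3 * (1 + u) =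
      u ^ 4 * (1 - 6 / 5 * s + s ^ 2 / 3 * (1 + u)) := by ring
  rw [scaledEta, hn, hd, mul_div_mul_left _ _ (pow_ne_zero 4 hu)]

/-- The polynomial system for the fixed point in the variables `u` and `s = g / u²`. -/
lemma exists_fixedPoint_polynomial :
    ∃ u s : ℝ, 0.3718 < u ∧ u < 0.373 ∧ 0.1233 ≤ s ∧ s ≤ 0.1235 ∧
      15 * (1 - u) - 90 * s + 18 * s * (1 - u) + 36 * s ^ 2
        + s ^ 2 * (1 + u) * (30 * s - 25 * (1 - u)) = 0 ∧
      3 * u * (1 - u - 6 * s) + 2 * s * (1 - u) * (1 - s * (1 + u + u ^ 2)) = 0 := by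
  let a : ℝ → ℝ := fun s => 15 + 18 * s - 50 * s ^ 2 - 30 * s ^ 3
  let b : ℝ → ℝ := fun s => 90 * s - 36 * s ^ 2 - 60 * s ^ 3
  let V : ℝ → ℝ := fun s => (-a s + √(a s ^ 2 + 100 * s ^ 2 * b s)) / (50 * s ^ 2)
  let f : ℝ → ℝ := fun s =>
    3 * (1 - V s) * (V s - 6 * s) + 2 * s * V s * (1 - s * (3 - 3 * V s + V s ^ 2))
  have hV : ∀ s ∈ Set.Icc (0.1233 : ℝ) 0.1235,
      0 ≤ V s ∧ 25 * s ^ 2 * V s ^ 2 + a s * V s - b s = 0 := by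
    rintro s ⟨h1, h2⟩
    have hs : 0 < s := by linarith
    have hb : 0 ≤ b s := by
      have : 0 ≤ s * (90 - 36 * s - 60 * s ^ 2) := mul_nonneg hs.le (by nlinarith)
      simp only [b]
      linarith
    have hΔ : 0 ≤ 100 * s ^ 2 * b s := by positivity
    have hsq := Real.sq_sqrt (show 0 ≤ a s ^ 2 + 100 * s ^ 2 * b s by positivity)
    have hle : a s ≤ √(a s ^ 2 + 100 * s ^ 2 * b s) := Real.le_sqrt_of_sq_le (by linarith)
    refine ⟨div_nonneg (by linarith) (by positivity), ?_⟩
    have hVs : 50 * s ^ 2 * V s = -a s + √(a s ^ 2 + 100 * s ^ 2 * b s) :=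
      mul_div_cancel₀ _ (by positivity)
    have key : 100 * s ^ 2 * (25 * s ^ 2 * V s ^ 2 + a s * V s - b s) = 0 := by
      linear_combination (50 * s ^ 2 * V s + a s + √(a s ^ 2 + 100 * s ^ 2 * b s)) * hVs + hsq
    exact (mul_eq_zero.mp key).resolve_left (by positivity)
  have hf : ContinuousOn f (Set.Icc 0.1233 0.1235) := by
    have hVc : ContinuousOn V (Set.Icc 0.1233 0.1235) := by
      refine ContinuousOn.div (by fun_prop) (by fun_prop) fun s hs => ?_
      have : 0 < s := by linarith [hs.1]
      positivity
    fun_prop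
  have hf0 : f 0.1233 ≤ 0 := by
    obtain ⟨h0, hE⟩ := hV 0.1233 (by norm_num)
    simp only [f]
    generalize V 0.1233 = v at *
    simp only [a, b] at hE
    have h1 : 0.62717 < v := by nlinarith
    have h2 : v < 0.6272 := by nlinarith
    nlinarith [mul_pos (sub_pos.2 h1) (sub_pos.2 h2), pow_pos (sub_pos.2 h1) 3]
  have hf1 : 0 ≤ f 0.1235 := by
    obtain ⟨h0, hE⟩ := hV 0.1235 (by norm_num)
    simp only [f]
    generalize V 0.1235 = v at *
    simp only [a, b] at hE
    have h1 : 0.62804 < v := by nlinarith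
    have h2 : v < 0.62806 := by nlinarith
    nlinarith [mul_pos (sub_pos.2 h1) (sub_pos.2 h2), pow_pos (sub_pos.2 h1) 3]
  obtain ⟨s, hs, hfs⟩ := intermediate_value_Icc (by norm_num) hf ⟨hf0, hf1⟩
  obtain ⟨h0, hE⟩ := hV s hs
  simp only [f] at hfs
  generalize V s = v at *
  simp only [a, b] at hE
  obtain ⟨hs0, hs1⟩ := hs
  have ha : 0 < 15 + 18 * s - 50 * s ^ 2 - 30 * s ^ 3 := by nlinarith
  have h1 : 0.627 < v := by
    by_contra! h
    have hv := mul_nonneg (sub_nonneg.2 h) ha.le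
    have hv3 : 25 * s ^ 2 * v ^ 2 ≤ 25 * s ^ 2 * 0.627 ^ 2 := by gcongr
    nlinarith [mul_nonneg (sub_nonneg.2 hs0) (sub_nonneg.2 hs1), pow_nonneg (sub_nonneg.2 hs0) 3]
  have h2 : v < 0.6282 := by
    by_contra! h
    have hv := mul_nonneg (sub_nonneg.2 h) ha.le
    have hv3 : 25 * s ^ 2 * 0.6282 ^ 2 ≤ 25 * s ^ 2 * v ^ 2 := by gcongr
    nlinarith [mul_nonneg (sub_nonneg.2 hs0) (sub_nonneg.2 hs1), pow_nonneg (sub_nonneg.2 hs0) 3,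
      mul_nonneg (mul_nonneg (sub_nonneg.2 hs0) (sub_nonneg.2 hs1)) (sub_nonneg.2 hs1)]
  refine ⟨1 - v, s, by linarith, by linarith, hs0, hs1, ?_, ?_⟩
  · linear_combination hE
  · linear_combination hfs

/-- The quotient rule, with the derivative expressed through the value of the quotient. -/
lemma HasDerivAt.div_quotient {f h : ℝ → ℝ} {f' h' x : ℝ} (hf : HasDerivAt f f' x)
    (hh : HasDerivAt h h' x) (hx : h x ≠ 0) :
    HasDerivAt (fun y => f y / h y) ((f' - f x / h x * h') / h x) x := by
  refine (hf.div hh hx).congr_deriv ?_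
  field_simp

section Derivatives

variable {u g : ℝ}

lemma hasDerivAt_scaledEta_left (hd : u ^ 4 - 6 / 5 * g * u ^ 2 + g ^ 2 / 3 * (1 + u) ≠ 0) :
    HasDerivAt (fun x => scaledEta x g)
      ((24 / 5 * g * (2 * u - 5 / 6 * g)
        - scaledEta u g * (4 * u ^ 3 - 12 / 5 * g * u + g ^ 2 / 3)) /
        (u ^ 4 - 6 / 5 * g * u ^ 2 + g ^ 2 / 3 * (1 + u))) u := by
  have hid := hasDerivAt_id u
  have hN := ((hid.pow 2).sub ((hid.const_add 1).const_mul (5 / 6 * g))).const_mul (24 / 5 * g)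
  have hD := ((hid.pow 4).sub ((hid.pow 2).const_mul (6 / 5 * g))).add
    ((hid.const_add 1).const_mul (g ^ 2 / 3))
  refine (hN.div_quotient hD hd).congr_deriv ?_
  simp only [scaledEta, Pi.sub_apply, Pi.add_apply, Pi.pow_apply, id_eq]
  ring

lemma hasDerivAt_scaledEta_right (hd : u ^ 4 - 6 / 5 * g * u ^ 2 + g ^ 2 / 3 * (1 + u) ≠ 0) :
    HasDerivAt (fun x => scaledEta u x)
      ((24 / 5 * (u ^ 2 - 5 / 3 * g * (1 + u))
        - scaledEta u g * (-(6 / 5) * u ^ 2 + 2 / 3 * g * (1 + u))) /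
        (u ^ 4 - 6 / 5 * g * u ^ 2 + g ^ 2 / 3 * (1 + u))) g := by
  have hid := hasDerivAt_id g
  have hN := (hid.const_mul (24 / 5)).mul
    (((hid.const_mul (5 / 6)).mul_const (1 + u)).const_sub (u ^ 2))
  have hD := (((hid.const_mul (6 / 5)).mul_const (u ^ 2)).const_sub (u ^ 4)).add
    (((hid.pow 2).div_const 3).mul_const (1 + u))
  refine (hN.div_quotient hD hd).congr_deriv ?_
  simp only [scaledEta, Pi.add_apply, Pi.pow_apply, Pi.mul_apply, id_eq]
  ring

lemma hasDerivAt_scaledBetaM_left (hu : u ≠ 0) {a : ℝ}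
    (h : HasDerivAt (fun x => scaledEta x g) a u) :
    HasDerivAt (fun x => scaledBetaM x g)
      (a * (1 - u) - (2 + scaledEta u g) - 2 * g * a / u ^ 2
        + 24 * g * (1 + scaledEta u g / 6) / u ^ 3) u := by
  have hid := hasDerivAt_id u
  refine (((h.const_add 2).mul (hid.const_sub 1)).sub
    ((((h.div_const 6).const_add 1).const_mul (12 * g)).div (hid.pow 2)
      (pow_ne_zero 2 hu))).congr_deriv ?_
  simp only [Pi.pow_apply, id_eq]
  field_simp
  ring

lemma hasDerivAt_scaledBetaM_right (u : ℝ) {b : ℝ}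
    (h : HasDerivAt (fun x => scaledEta u x) b g) :
    HasDerivAt (fun x => scaledBetaM u x)
      (b * (1 - u) - 12 * (1 + scaledEta u g / 6) / u ^ 2 - 2 * g * b / u ^ 2) g := by
  have hid := hasDerivAt_id g
  refine (((h.const_add 2).mul_const (1 - u)).sub
    (((hid.const_mul 12).mul ((h.div_const 6).const_add 1)).div_const (u ^ 2))).congr_deriv ?_
  simp only [id_eq]
  ring

lemma hasDerivAt_scaledBetaLam_left (hu : u ≠ 0) {a : ℝ}
    (h : HasDerivAt (fun x => scaledEta x g) a u) :
    HasDerivAt (fun x => scaledBetaLam x g)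
      (-2 * a + (2 / 3 * g * a / u ^ 3 - 12 * g * (1 + scaledEta u g / 6) / u ^ 4)
          * (1 - g * (1 / u ^ 2 + 1 + 1 / u))
        + 4 * g ^ 2 * (1 + scaledEta u g / 6) / u ^ 3 * (2 / u ^ 3 + 1 / u ^ 2)) u := by
  have hid := hasDerivAt_id u
  have hP := (((h.div_const 6).const_add 1).const_mul (4 * g)).div (hid.pow 3) (pow_ne_zero 3 hu)
  have hB := ((((hasDerivAt_const u (1 : ℝ)).div (hid.pow 2) (pow_ne_zero 2 hu)).add_const 1).add
    ((hasDerivAt_const u (1 : ℝ)).div hid hu)).const_mul g |>.const_sub 1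
  refine ((h.const_mul (-2)).add (hP.mul hB)).congr_deriv ?_
  simp only [Pi.pow_apply, Pi.div_apply, Pi.add_apply, id_eq]
  field_simp
  ring

lemma hasDerivAt_scaledBetaLam_right (u : ℝ) {b : ℝ}
    (h : HasDerivAt (fun x => scaledEta u x) b g) :
    HasDerivAt (fun x => scaledBetaLam u x)
      (-2 * b + (4 * (1 + scaledEta u g / 6) + 2 / 3 * g * b) / u ^ 3
          * (1 - g * (1 / u ^ 2 + 1 + 1 / u))
        - 4 * g * (1 + scaledEta u g / 6) / u ^ 3 * (1 / u ^ 2 + 1 + 1 / u)) g := by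
  have hid := hasDerivAt_id g
  have hP := ((hid.const_mul 4).mul ((h.div_const 6).const_add 1)).div_const (u ^ 3)
  have hB := (hid.mul_const (1 / u ^ 2 + 1 + 1 / u)).const_sub 1
  refine ((h.const_mul (-2)).add (hP.mul hB)).congr_deriv ?_
  simp only [Pi.mul_apply, id_eq]
  ring

end Derivatives

lemma differentiableAt_scaledBeta {x : ℝ × ℝ} (hu : x.1 ≠ 0)
    (hd : x.1 ^ 4 - 6 / 5 * x.2 * x.1 ^ 2 + x.2 ^ 2 / 3 * (1 + x.1) ≠ 0) :
    DifferentiableAt ℝ (fun y : ℝ × ℝ => scaledBetaM y.1 y.2) x ∧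
      DifferentiableAt ℝ (fun y : ℝ × ℝ => scaledBetaLam y.1 y.2) x := by
  have hu2 := pow_ne_zero 2 hu
  have hu3 := pow_ne_zero 3 hu
  have he : DifferentiableAt ℝ (fun y : ℝ × ℝ => scaledEta y.1 y.2) x := by
    unfold scaledEta
    fun_prop (disch := assumption)
  constructor
  · unfold scaledBetaM
    fun_prop (disch := assumption)
  · unfold scaledBetaLam
    fun_prop (disch := assumption)

set_option maxHeartbeats 2000000 in
/-- The fixed point in the variables `u = 1 + m̄²`, `g = π² λ̄ / √5`, with the signs of the entries
of the Jacobian. -/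
lemma exists_scaled_fixedPoint :
    ∃ u g : ℝ, 0.3718 < u ∧ u < 0.373 ∧ 0.017 < g ∧ g < 0.0172 ∧
      u ^ 4 - 6 / 5 * g * u ^ 2 + g ^ 2 / 3 * (1 + u) ≠ 0 ∧
      scaledBetaM u g = 0 ∧ scaledBetaLam u g = 0 ∧
      ∃ Mu Mg Lu Lg : ℝ,
        HasDerivAt (fun x => scaledBetaM x g) Mu u ∧
        HasDerivAt (fun x => scaledBetaM u x) Mg g ∧
        HasDerivAt (fun x => scaledBetaLam x g) Lu u ∧
        HasDerivAt (fun x => scaledBetaLam u x) Lg g ∧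
        0 < Mu ∧ Mg < 0 ∧ Lu < 0 ∧ Lg < 0 := by
  obtain ⟨u, s, hu0, hu1, hs0, hs1, hE1, hE2⟩ := exists_fixedPoint_polynomial
  have hu : 0 < u := by linarith
  have hs : 0 < s := by linarith
  have hune := hu.ne'
  have hs2l : 0.1233 ^ 2 ≤ s ^ 2 := by gcongr
  have hs2r : s ^ 2 ≤ 0.1235 ^ 2 := by gcongr
  have hsul : 0.1233 * 0.3718 ≤ s * u := by gcongr
  have hsur : s * u ≤ 0.1235 * 0.373 := by gcongr
  have hsu2l : 0.1233 * 0.3718 ^ 2 ≤ s * u ^ 2 := by gcongr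
  have hsu2r : s * u ^ 2 ≤ 0.1235 * 0.373 ^ 2 := by gcongr
  have hssul : 0.1233 ^ 2 * 0.3718 ≤ s ^ 2 * u := by gcongr
  have hssur : s ^ 2 * u ≤ 0.1235 ^ 2 * 0.373 := by gcongr
  obtain ⟨e, he⟩ : ∃ e, e = scaledEta u (s * u ^ 2) := ⟨_, rfl⟩
  obtain ⟨d, hd⟩ : ∃ d, d = 1 - 6 / 5 * s + s ^ 2 / 3 * (1 + u) := ⟨_, rfl⟩
  have hdl : 0.8587 < d := by linarith
  have hdr : d < 0.8591 := by linarith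
  have hd0 : d ≠ 0 := by linarith
  have hD : u ^ 4 - 6 / 5 * (s * u ^ 2) * u ^ 2 + (s * u ^ 2) ^ 2 / 3 * (1 + u) = u ^ 4 * d := by
    rw [hd]
    ring
  have hDne : u ^ 4 - 6 / 5 * (s * u ^ 2) * u ^ 2 + (s * u ^ 2) ^ 2 / 3 * (1 + u) ≠ 0 := by
    rw [hD]
    positivity
  have hed : e * d = 24 / 5 * s * (1 - 5 / 6 * s * (1 + u)) := by
    rw [he, scaledEta_mul_sq hune, ← hd, div_mul_cancel₀ _ hd0]
  have hM : e * (1 - u - 2 * s) + 2 * (1 - u) - 12 * s = 0 := by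
    refine mul_left_cancel₀ hd0 ?_
    linear_combination (1 - u - 2 * s) * hed + (2 / 15) * hE1 + (2 * (1 - u) - 12 * s) * hd
  have hel : 0.584 < e := by
    by_contra! h
    linarith [mul_nonneg (sub_nonneg.2 h) (show 0 ≤ 1 - u - 2 * s by linarith)]
  have her : e < 0.601 := by
    by_contra! h
    linarith [mul_nonneg (sub_nonneg.2 h) (show 0 ≤ 1 - u - 2 * s by linarith)]
  obtain ⟨B, hB⟩ : ∃ B, B = 1 - s * (1 + u + u ^ 2) := ⟨_, rfl⟩
  rw [← hB] at hE2
  have hBl : 0.8132 < B := by linarith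
  have hBr : B < 0.8139 := by linarith
  have hL : -2 * e * u + 4 * s * (1 + e / 6) * B = 0 := by
    refine mul_left_cancel₀ (show 1 - u - 2 * s ≠ 0 by linarith) ?_
    linear_combination 4 / 3 * hE2 + (-2 * u + 2 / 3 * s * B) * hM
  obtain ⟨a, ha⟩ : ∃ a, a =
      (24 / 5 * s * (2 - 5 / 6 * (s * u)) - e * (4 - 12 / 5 * s + s ^ 2 * u / 3)) / d := ⟨_, rfl⟩
  obtain ⟨b, hb⟩ : ∃ b, b = (24 / 5 * (1 - 5 / 3 * (s + s * u))
      - e * (-(6 / 5) + 2 / 3 * (s + s * u))) / d := ⟨_, rfl⟩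
  have hssu : 0.0056 < s * (s * u) ∧ s * (s * u) < 0.0057 := by
    constructor <;> linarith
  have hal : -1.26 < a := by
    have hk : e * (4 - 12 / 5 * s + s ^ 2 * u / 3) ≤ 0.601 * 3.7065 :=
      mul_le_mul her.le (by linarith) (by linarith) (by norm_num)
    rw [ha, lt_div_iff₀ (by linarith)]
    linarith [hssu.2]
  have har : a < -1.16 := by
    have hk : 0.584 * 3.7052 ≤ e * (4 - 12 / 5 * s + s ^ 2 * u / 3) :=
      mul_le_mul hel.le (by linarith) (by norm_num) (by linarith)
    rw [ha, div_lt_iff₀ (by linarith)]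
    linarith [hssu.1]
  have hbl : 4.7 < b := by
    have hk : 0.584 * 1.0868 ≤ e * (6 / 5 - 2 / 3 * (s + s * u)) :=
      mul_le_mul hel.le (by linarith) (by norm_num) (by linarith)
    rw [hb, lt_div_iff₀ (by linarith)]
    linarith
  have hbr : b < 4.82 := by
    have hk : e * (6 / 5 - 2 / 3 * (s + s * u)) ≤ 0.601 * 1.0874 :=
      mul_le_mul her.le (by linarith) (by linarith) (by norm_num)
    rw [hb, div_lt_iff₀ (by linarith)]
    linarith
  have hsBl : 0.1233 * 0.8132 ≤ s * B := mul_le_mul hs0 hBl.le (by norm_num) hs.le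
  have hsBr : s * B ≤ 0.1235 * 0.8139 := mul_le_mul hs1 hBr.le (by linarith) (by norm_num)
  have hEu : HasDerivAt (fun x => scaledEta x (s * u ^ 2)) (a / u) u := by
    refine (hasDerivAt_scaledEta_left hDne).congr_deriv ?_
    rw [hD, ha, ← he]
    field_simp
  have hEg : HasDerivAt (fun x => scaledEta u x) (b / u ^ 2) (s * u ^ 2) := by
    refine (hasDerivAt_scaledEta_right hDne).congr_deriv ?_
    rw [hD, hb, ← he]
    field_simp
  refine ⟨u, s * u ^ 2, hu0, hu1, by linarith, by linarith, hDne, ?_, ?_, _, _, _, _,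
    hasDerivAt_scaledBetaM_left hune hEu, hasDerivAt_scaledBetaM_right u hEg,
    hasDerivAt_scaledBetaLam_left hune hEu, hasDerivAt_scaledBetaLam_right u hEg, ?_, ?_, ?_, ?_⟩
  · rw [scaledBetaM, ← he]
    field_simp
    linear_combination 6 * hM
  · rw [scaledBetaLam, ← he]
    field_simp
    linear_combination 6 * hL - 24 * s * (1 + e / 6) * hB
  · rw [← he]
    have : a / u * (1 - u) - (2 + e) - 2 * (s * u ^ 2) * (a / u) / u ^ 2
        + 24 * (s * u ^ 2) * (1 + e / 6) / u ^ 3 =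
        (a * (1 - u - 2 * s) - (2 + e) * u + 24 * s * (1 + e / 6)) / u := by
      field_simp
      ring
    rw [this]
    refine div_pos ?_ hu
    have h1 : -a * (1 - u - 2 * s) ≤ 1.26 * 0.3816 :=
      mul_le_mul (by linarith) (by linarith) (by linarith) (by norm_num)
    have h2 : (2 + e) * u ≤ 2.601 * 0.373 :=
      mul_le_mul (by linarith) hu1.le hu.le (by norm_num)
    have h3 : 0.1233 * 1 ≤ s * (1 + e / 6) :=
      mul_le_mul hs0 (by linarith) (by norm_num) hs.le
    linarith
  · rw [← he]
    have : b / u ^ 2 * (1 - u) - 12 * (1 + e / 6) / u ^ 2 - 2 * (s * u ^ 2) * (b / u ^ 2) / u ^ 2 =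
        (b * (1 - u - 2 * s) - 12 * (1 + e / 6)) / u ^ 2 := by
      field_simp
      ring
    rw [this]
    refine div_neg_of_neg_of_pos ?_ (by positivity)
    have h1 : b * (1 - u - 2 * s) ≤ 4.82 * 0.3816 :=
      mul_le_mul hbr.le (by linarith) (by linarith) (by norm_num)
    linarith
  · rw [← he]
    have : -2 * (a / u) + (2 / 3 * (s * u ^ 2) * (a / u) / u ^ 3
          - 12 * (s * u ^ 2) * (1 + e / 6) / u ^ 4) *
          (1 - s * u ^ 2 * (1 / u ^ 2 + 1 + 1 / u))
        + 4 * (s * u ^ 2) ^ 2 * (1 + e / 6) / u ^ 3 * (2 / u ^ 3 + 1 / u ^ 2) =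
        (-2 * a * u + 2 / 3 * s * a * B - 12 * s * (1 + e / 6) * B
          + 4 * s ^ 2 * (1 + e / 6) * (2 + u)) / u ^ 2 := by
      rw [hB]
      field_simp
      ring
    rw [this]
    refine div_neg_of_neg_of_pos ?_ (by positivity)
    have h1 : -a * (2 * u - 2 / 3 * (s * B)) ≤ 1.26 * 0.68 :=
      mul_le_mul (by linarith) (by linarith) (by linarith) (by norm_num)
    have h2 : 0.1233 * 0.8132 * 1.09 ≤ s * B * (1 + e / 6) :=
      mul_le_mul hsBl (by linarith) (by norm_num) (by positivity)
    have h3 : s ^ 2 * (2 + u) * (1 + e / 6) ≤ 0.01526 * 2.373 * 1.11 := by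
      gcongr <;> linarith
    linarith
  · rw [← he]
    have : -2 * (b / u ^ 2) + (4 * (1 + e / 6) + 2 / 3 * (s * u ^ 2) * (b / u ^ 2)) / u ^ 3
          * (1 - s * u ^ 2 * (1 / u ^ 2 + 1 + 1 / u))
        - 4 * (s * u ^ 2) * (1 + e / 6) / u ^ 3 * (1 / u ^ 2 + 1 + 1 / u) =
        (-2 * b * u + 2 / 3 * s * b * B + 4 * (1 + e / 6) * (2 * B - 1)) / u ^ 3 := by
      rw [hB]
      field_simp
      ring
    rw [this]
    refine div_neg_of_neg_of_pos ?_ (by positivity)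
    have h1 : 4.7 * 0.676 ≤ b * (2 * u - 2 / 3 * (s * B)) :=
      mul_le_mul hbl.le (by linarith) (by norm_num) (by linarith)
    have h2 : (1 + e / 6) * (2 * B - 1) ≤ 1.11 * 0.628 :=
      mul_le_mul (by linarith) (by linarith) (by linarith) (by norm_num)
    linarith

/-- FP1 is hyperbolic with one relevant and one irrelevant
direction: there is a fixed point in the stated window at which the flow map
`(m̄², λ̄) ↦ (β_m, β_λ)` is differentiable in a neighbourhood and the determinant
of its Jacobian matrix is strictly negative, so the Jacobian has two real
eigenvalues of opposite signs. -/
theorem FP1_hyperbolic :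
    ∃ m lam : ℝ, m ∈ Set.Ioo (-0.65 : ℝ) (-0.60 : ℝ) ∧
      lam ∈ Set.Ioo (0.003 : ℝ) (0.005 : ℝ) ∧
      betaM m lam = 0 ∧ betaLam m lam = 0 ∧
      (∀ᶠ x : ℝ × ℝ in nhds (m, lam),
        DifferentiableAt ℝ (fun y : ℝ × ℝ => (betaM y.1 y.2, betaLam y.1 y.2)) x) ∧
      deriv (fun t => betaM t lam) m * deriv (fun t => betaLam m t) lam
        - deriv (fun t => betaM m t) lam * deriv (fun t => betaLam t lam) m < 0 := by
  obtain ⟨u, g, hu0, hu1, hg0, hg1, hD, hM, hL, Mu, Mg, Lu, Lg, hMu, hMg, hLu, hLg,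
    hMu0, hMg0, hLu0, hLg0⟩ := exists_scaled_fixedPoint
  set c := π ^ 2 / √5 with hc
  have hc0 : 0 < c := by positivity
  have h5l : 2.236 < √5 := Real.lt_sqrt_of_sq_lt (by norm_num)
  have h5r : √5 < 2.2361 := (Real.sqrt_lt' (by norm_num)).2 (by norm_num)
  have hcl : 4.3 < c := by
    rw [hc, lt_div_iff₀ (by positivity)]
    nlinarith [Real.pi_gt_d2]
  have hcr : c < 4.5 := by
    rw [hc, div_lt_iff₀ (by positivity)]
    nlinarith [Real.pi_lt_d2, Real.pi_pos]
  have hcg : c * (g / c) = g := mul_div_cancel₀ _ hc0.ne'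
  have hum : 1 + (u - 1) = u := by ring
  have hl0 : 0.003 < g / c := by
    rw [lt_div_iff₀ hc0]
    linarith
  have hl1 : g / c < 0.005 := by
    rw [div_lt_iff₀ hc0]
    linarith
  refine ⟨u - 1, g / c, ⟨by linarith, by linarith⟩, ⟨hl0, hl1⟩, ?_, ?_, ?_, ?_⟩
  · rw [betaM_eq_scaledBetaM, ← hc, hcg, hum, hM]
  · rw [betaLam_eq_scaledBetaLam, ← hc, hcg, hum, hL, mul_zero]
  · have hev : ∀ᶠ x : ℝ × ℝ in nhds (u - 1, g / c), 1 + x.1 ≠ 0 ∧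
        (1 + x.1) ^ 4 - 6 / 5 * (c * x.2) * (1 + x.1) ^ 2
          + (c * x.2) ^ 2 / 3 * (1 + (1 + x.1)) ≠ 0 := by
      refine .and (ContinuousAt.eventually_ne (by fun_prop) ?_)
        (ContinuousAt.eventually_ne (by fun_prop) ?_)
      · simp only [hum]
        linarith
      · simpa only [hum, hcg] using hD
    filter_upwards [hev] with x hx
    simp only [betaM_eq_scaledBetaM, betaLam_eq_scaledBetaLam, ← hc]
    have hφ : DifferentiableAt ℝ (fun y : ℝ × ℝ => (1 + y.1, c * y.2)) x := by fun_prop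
    obtain ⟨h1, h2⟩ := differentiableAt_scaledBeta (x := (1 + x.1, c * x.2)) hx.1 hx.2
    have h3 : DifferentiableAt ℝ (fun y : ℝ × ℝ => scaledBetaM (1 + y.1) (c * y.2)) x :=
      DifferentiableAt.comp (g := fun y : ℝ × ℝ => scaledBetaM y.1 y.2) x h1 hφ
    have h4 : DifferentiableAt ℝ (fun y : ℝ × ℝ => scaledBetaLam (1 + y.1) (c * y.2)) x :=
      DifferentiableAt.comp (g := fun y : ℝ × ℝ => scaledBetaLam y.1 y.2) x h2 hφ
    exact h3.prodMk (differentiableAt_snd.mul h4)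
  · simp only [betaM_eq_scaledBetaM, betaLam_eq_scaledBetaLam, ← hc, hcg, hum]
    have hmul := (hasDerivAt_id (g / c)).const_mul c
    rw [mul_one] at hmul
    have d1 : deriv (fun t => scaledBetaM (1 + t) g) (u - 1) = Mu := by
      rw [deriv_comp_const_add (fun t => scaledBetaM t g), hum, hMu.deriv]
    have d2 : deriv (fun t => g / c * scaledBetaLam (1 + t) g) (u - 1) = g / c * Lu := by
      have h := hLu
      rw [← hum] at h
      exact ((h.comp_const_add 1 (u - 1)).const_mul (g / c)).deriv
    have d3 : deriv (fun t => scaledBetaM u (c * t)) (g / c) = c * Mg := by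
      rw [deriv_comp_mul_left c (scaledBetaM u), hcg, hMg.deriv, smul_eq_mul]
    have d4 : deriv (fun t => t * scaledBetaLam u (c * t)) (g / c) = g * Lg := by
      have h := hLg
      rw [← hcg] at h
      have h' := (hasDerivAt_id (g / c)).mul (h.comp (g / c) hmul)
      refine h'.deriv.trans ?_
      simp only [Function.comp_apply, id_eq, hcg, hL]
      field_simp
      ring
    rw [d1, d2, d3, d4]
    have hdet : Mu * (g * Lg) - c * Mg * (g / c * Lu) = g * (Mu * Lg - Mg * Lu) := by
      field_simp
    rw [hdet]
    have hg : 0 < g := by linarith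
    exact mul_neg_of_pos_of_neg hg
      (by linarith [mul_neg_of_pos_of_neg hMu0 hLg0, mul_pos_of_neg_of_neg hMg0 hLu0])
end

section
/- (Asymptotic freedom of the quartic melonic model.) With η and β_λ defined as in the context, the restriction of β_λ to vanishing dimensionless mass satisfies lim_{λ̄ → 0, λ̄ ≠ 0} β_λ(0, λ̄)/λ̄² = −28π²/(5√5); i.e. near the Gaussian fixed point, β_{λ₄} = −(28π²/(5√5))·λ̄₄² + o(λ̄₄²). -/
open Real

theorem tendsto_eta_div_nhdsNE_zero :
    Filter.Tendsto (fun lam : ℝ => eta 0 lam / lam)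
      (nhdsWithin 0 {(0 : ℝ)}ᶜ) (nhds (24 * π ^ 2 / (5 * Real.sqrt 5))) := by
  have hcont : ContinuousAt (fun lam : ℝ => (24 * π ^ 2 / (5 * Real.sqrt 5)) *
      ((1 + 0) ^ 2 - (π ^ 2 * Real.sqrt 5 * lam / 6) * (2 + 0)) / etaDenom 0 lam) 0 := by
    refine ContinuousAt.div (by fun_prop) ?_ (by simp [etaDenom])
    unfold etaDenom
    fun_prop
  have hlim := hcont.tendsto.mono_left (nhdsWithin_le_nhds (s := {(0 : ℝ)}ᶜ))
  have hval : (24 * π ^ 2 / (5 * Real.sqrt 5)) *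
      ((1 + 0) ^ 2 - (π ^ 2 * Real.sqrt 5 * 0 / 6) * (2 + 0)) / etaDenom 0 0
        = 24 * π ^ 2 / (5 * Real.sqrt 5) := by
    simp [etaDenom]
  rw [hval] at hlim
  refine hlim.congr' ?_
  filter_upwards [self_mem_nhdsWithin] with lam (hlam : lam ≠ 0)
  rw [eta, eq_div_iff hlam]
  ring

/-- Asymptotic freedom of the quartic melonic model: near the
Gaussian fixed point, `β_{λ₄}(0, λ̄)/λ̄² → −28π²/(5√5)` as `λ̄ → 0`, `λ̄ ≠ 0`,
i.e. `β_{λ₄} = −(28π²/(5√5))λ̄₄² + o(λ̄₄²)`. -/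
theorem asymptotic_freedom :
    Filter.Tendsto (fun lam : ℝ => betaLam 0 lam / lam ^ 2)
      (nhdsWithin 0 {(0 : ℝ)}ᶜ) (nhds (-(28 * π ^ 2 / (5 * Real.sqrt 5)))) := by
  have hid : Filter.Tendsto (fun lam : ℝ => lam) (nhdsWithin 0 {(0 : ℝ)}ᶜ) (nhds 0) :=
    nhdsWithin_le_nhds
  have heta : Filter.Tendsto (fun lam : ℝ => eta 0 lam)
      (nhdsWithin 0 {(0 : ℝ)}ᶜ) (nhds 0) := by
    have h := tendsto_eta_div_nhdsNE_zero.mul hid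
    rw [mul_zero] at h
    refine h.congr' ?_
    filter_upwards [self_mem_nhdsWithin] with lam (hlam : lam ≠ 0)
    exact div_mul_cancel₀ _ hlam
  have hvertex : Filter.Tendsto (fun lam : ℝ => (4 * π ^ 2 / Real.sqrt 5) *
      (1 + eta 0 lam / 6) * (1 - (π ^ 2 / Real.sqrt 5) * 3 * lam))
      (nhdsWithin 0 {(0 : ℝ)}ᶜ)
      (nhds ((4 * π ^ 2 / Real.sqrt 5) * (1 + 0 / 6) *
        (1 - (π ^ 2 / Real.sqrt 5) * 3 * 0))) :=
    (((heta.div_const 6).const_add 1).const_mul _).mul ((hid.const_mul _).const_sub 1)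
  have hsum := (tendsto_eta_div_nhdsNE_zero.const_mul (-2)).add hvertex
  have hval : -2 * (24 * π ^ 2 / (5 * Real.sqrt 5)) + (4 * π ^ 2 / Real.sqrt 5) * (1 + 0 / 6) *
        (1 - (π ^ 2 / Real.sqrt 5) * 3 * 0) = -(28 * π ^ 2 / (5 * Real.sqrt 5)) := by
    ring
  rw [hval] at hsum
  refine hsum.congr' ?_
  filter_upwards [self_mem_nhdsWithin] with lam (hlam : lam ≠ 0)
  rw [betaLam]
  generalize eta 0 lam = e
  field_simp
  ring
end

section
/- (Existence of the unphysical fixed points FP2 and FP3.) With η, β_m, β_λ defined as in the context (defined whenever 1 + m̄² ≠ 0 and the denominator of η is nonzero), there exist: (i) a point (m̄²₂, λ̄₂) with m̄²₂ ∈ (−1.05, −1.01) (so m̄²₂ < −1, disconnected from the Gaussian region) and λ̄₂ ∈ (0.0001, 0.0004) with β_m = β_λ = 0 and η(m̄²₂, λ̄₂) < −2; and (ii) a point (m̄²₃, λ̄₃) with m̄²₃ ∈ (−0.78, −0.72) and λ̄₃ ∈ (−0.026, −0.020) (negative quartic coupling) with β_m = β_λ = 0 and η(m̄²₃, λ̄₃)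 < −2. In both cases the anomalous dimension violates the physical bound η > −2. -/
open Real

/-- Along a parameter interval, the branch of roots of a quadratic selected by the sign `σ` meets
the zero set of `F` as soon as `F` changes sign along this branch. -/
theorem exists_quadratic_root_eq_zero {a b c : ℝ → ℝ} {F : ℝ → ℝ → ℝ} {σ p q y : ℝ}
    (hσ : σ * σ = 1) (hpq : p ≤ q)
    (ha : Continuous a) (hb : Continuous b) (hc : Continuous c)
    (hF : Continuous fun z : ℝ × ℝ => F z.1 z.2)
    (hpos : ∀ u ∈ Set.Icc p q, 0 < a u)
    (hy : ∀ u ∈ Set.Icc p q, a u * y ^ 2 + b u * y + c u ≤ 0)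
    (hp : ∀ x, a p * x ^ 2 + b p * x + c p = 0 → 0 ≤ σ * (2 * a p * x + b p) → F p x ≤ 0)
    (hq : ∀ x, a q * x ^ 2 + b q * x + c q = 0 → 0 ≤ σ * (2 * a q * x + b q) → 0 ≤ F q x) :
    ∃ u ∈ Set.Icc p q, ∃ x, a u * x ^ 2 + b u * x + c u = 0 ∧
      0 ≤ σ * (2 * a u * x + b u) ∧ F u x = 0 := by
  have hdisc : ∀ u ∈ Set.Icc p q, 0 ≤ b u ^ 2 - 4 * a u * c u := by
    intro u hu
    nlinarith [mul_nonneg (hpos u hu).le (neg_nonneg.mpr (hy u hu)), sq_nonneg (2 * a u * y + b u)]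
  set X : ℝ → ℝ := fun u => (-b u + σ * √(b u ^ 2 - 4 * a u * c u)) / (2 * a u) with hX
  have hlin : ∀ u ∈ Set.Icc p q, 2 * a u * X u + b u = σ * √(b u ^ 2 - 4 * a u * c u) := by
    intro u hu
    have := (hpos u hu).ne'
    simp only [hX]
    field_simp
    ring
  have hbranch : ∀ u ∈ Set.Icc p q, 0 ≤ σ * (2 * a u * X u + b u) := by
    intro u hu
    rw [hlin u hu, ← mul_assoc, hσ, one_mul]
    positivity
  have hroot : ∀ u ∈ Set.Icc p q, a u * X u ^ 2 + b u * X u + c u = 0 := by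
    intro u hu
    have h1 : (2 * a u * X u + b u) ^ 2 = b u ^ 2 - 4 * a u * c u := by
      rw [hlin u hu, mul_pow, Real.sq_sqrt (hdisc u hu), pow_two σ, hσ, one_mul]
    have h2 : 4 * a u * (a u * X u ^ 2 + b u * X u + c u) = 0 := by linear_combination h1
    exact (mul_eq_zero.mp h2).resolve_left (by linarith [hpos u hu])
  have hXc : ContinuousOn X (Set.Icc p q) := by
    refine ContinuousOn.div (by fun_prop) (by fun_prop) fun u hu => ?_
    linarith [hpos u hu]
  have hFc : ContinuousOn (fun u => F u (X u)) (Set.Icc p q) :=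
    hF.comp_continuousOn (continuousOn_id.prodMk hXc)
  have hpm := Set.left_mem_Icc.mpr hpq
  have hqm := Set.right_mem_Icc.mpr hpq
  obtain ⟨u, hu, hu0⟩ := intermediate_value_Icc hpq hFc
    ⟨hp _ (hroot p hpm) (hbranch p hpm), hq _ (hroot q hqm) (hbranch q hqm)⟩
  exact ⟨u, hu, X u, hroot u hu, hbranch u hu, hu0⟩

theorem lt_larger_quadratic_root {a b c x l : ℝ} (ha : 0 < a) (hx : a * x ^ 2 + b * x + c = 0)
    (hbr : 0 ≤ 2 * a * x + b) (hl : a * l ^ 2 + b * l + c < 0) : l < x := by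
  by_contra! h
  nlinarith [mul_nonneg hbr (sub_nonneg.mpr h), mul_nonneg ha.le (sq_nonneg (l - x))]

theorem larger_quadratic_root_lt {a b c x h : ℝ} (ha : 0 < a) (hx : a * x ^ 2 + b * x + c = 0)
    (hh : 0 < a * h ^ 2 + b * h + c) (hv : 0 ≤ 2 * a * h + b) : x < h := by
  by_contra! hle
  nlinarith [mul_nonneg hv (sub_nonneg.mpr hle), mul_nonneg ha.le (sq_nonneg (x - h))]

theorem lt_smaller_quadratic_root {a b c x l : ℝ} (ha : 0 < a) (hx : a * x ^ 2 + b * x + c = 0)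
    (hl : 0 < a * l ^ 2 + b * l + c) (hv : 2 * a * l + b ≤ 0) : l < x := by
  have := larger_quadratic_root_lt (b := -b) (c := c) (x := -x) (h := -l) ha
    (by linarith) (by linarith) (by linarith)
  linarith

theorem smaller_quadratic_root_lt {a b c x h : ℝ} (ha : 0 < a) (hx : a * x ^ 2 + b * x + c = 0)
    (hbr : 2 * a * x + b ≤ 0) (hh : a * h ^ 2 + b * h + c < 0) : x < h := by
  have := lt_larger_quadratic_root (b := -b) (c := c) (x := -x) (l := -h) ha
    (by linarith) (by linarith) (by linarith)
  linarith

/-- The coupling `λ̄` for which `π² λ̄ / √5 = u x²`. -/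
noncomputable def rescaledCoupling (u x : ℝ) : ℝ := √5 * (u * x ^ 2) / π ^ 2

theorem etaDenom_rescaled (u x : ℝ) :
    etaDenom (x - 1) (rescaledCoupling u x) =
      x ^ 4 * (1 - 6 / 5 * u + u ^ 2 / 3 * (1 + x)) := by
  have h5 : (√5 : ℝ) ≠ 0 := by positivity
  have h5' : (√5 : ℝ) ^ 2 = 5 := Real.sq_sqrt (by norm_num)
  have hpi := Real.pi_ne_zero
  unfold etaDenom rescaledCoupling
  field_simp
  rw [h5']
  ring

theorem eta_rescaled {u x : ℝ} (hx : x ≠ 0) :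
    eta (x - 1) (rescaledCoupling u x) =
      24 / 5 * u * (1 - 5 / 6 * u * (1 + x)) / (1 - 6 / 5 * u + u ^ 2 / 3 * (1 + x)) := by
  have h5 : (√5 : ℝ) ≠ 0 := by positivity
  have h5' : (√5 : ℝ) ^ 2 = 5 := Real.sq_sqrt (by norm_num)
  have hpi := Real.pi_ne_zero
  have hnum : 24 * π ^ 2 * rescaledCoupling u x / (5 * √5) *
      ((1 + (x - 1)) ^ 2 - π ^ 2 * √5 * rescaledCoupling u x / 6 * (2 + (x - 1))) =
      x ^ 4 * (24 / 5 * u * (1 - 5 / 6 * u * (1 + x))) := by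
    unfold rescaledCoupling
    field_simp
    rw [h5']
    ring
  rw [eta, etaDenom_rescaled, hnum, mul_div_mul_left _ _ (pow_ne_zero 4 hx)]

/-- In the variables `x = 1 + m̄²` and `u = π² λ̄ / (√5 x²)` the fixed point equations are
polynomial. -/
theorem fixed_point_of_rescaled {u x : ℝ} (hx : x ≠ 0)
    (hd : 1 - 6 / 5 * u + u ^ 2 / 3 * (1 + x) ≠ 0)
    (hm : 25 * u ^ 2 * x ^ 2 + (30 * u ^ 3 - 18 * u - 15) * x
      + (30 * u ^ 3 + 11 * u ^ 2 - 72 * u + 15) = 0)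
    (hl : x * (12 / 5) * (1 - 5 / 6 * u * (1 + x))
      - (1 - 2 / 5 * u - u ^ 2 / 3 * (1 + x)) * (1 - u * (1 + x + x ^ 2)) = 0) :
    betaM (x - 1) (rescaledCoupling u x) = 0 ∧ betaLam (x - 1) (rescaledCoupling u x) = 0 := by
  have h5 : (√5 : ℝ) ≠ 0 := by positivity
  have hpi := Real.pi_ne_zero
  set d := 1 - 6 / 5 * u + u ^ 2 / 3 * (1 + x) with hd_def
  set e := eta (x - 1) (rescaledCoupling u x) with he
  have hed : e * d = 24 / 5 * u * (1 - 5 / 6 * u * (1 + x)) := by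
    rw [he, eta_rescaled hx, div_mul_cancel₀ _ hd]
  have hg : π ^ 2 / √5 * rescaledCoupling u x = u * x ^ 2 := by
    unfold rescaledCoupling
    field_simp
  have hx1 : 1 + (x - 1) = x := by ring
  constructor
  · have h1 : betaM (x - 1) (rescaledCoupling u x)
        = -(2 + e) * (x - 1) - 12 * u * (1 + e / 6) := by
      rw [betaM, ← he, hx1]
      have : 12 * π ^ 2 / √5 * rescaledCoupling u x = 12 * (u * x ^ 2) := by
        rw [← hg]; ring
      rw [this]
      field_simp
    rw [h1]
    refine (mul_eq_zero.mp ?_).resolve_right hd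
    linear_combination (-(x - 1) - 2 * u) * hed + (2 / 15) * hm
      + (-2 * (x - 1) - 12 * u) * hd_def
  · have h1 : betaLam (x - 1) (rescaledCoupling u x) = rescaledCoupling u x *
        (-2 * e + 4 * u * (1 + e / 6) / x * (1 - u * (1 + x + x ^ 2))) := by
      rw [betaLam, ← he, hx1]
      have h2 : 4 * π ^ 2 * rescaledCoupling u x ^ 2 / √5
          = 4 * (u * x ^ 2) * rescaledCoupling u x := by
        rw [← hg]; ring
      have h3 : π ^ 2 * rescaledCoupling u x / √5 = u * x ^ 2 := by
        rw [← hg]; ring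
      rw [h2, h3]
      field_simp
      ring
    rw [h1]
    refine mul_eq_zero_of_right _ ((mul_eq_zero.mp ?_).resolve_right (mul_ne_zero hx hd))
    have h2 : (-2 * e + 4 * u * (1 + e / 6) / x * (1 - u * (1 + x + x ^ 2))) * (x * d)
        = (-2 * e * x + 4 * u * (1 + e / 6) * (1 - u * (1 + x + x ^ 2))) * d := by
      field_simp
    rw [h2]
    linear_combination (-2 * x + 2 / 3 * u * (1 - u * (1 + x + x ^ 2))) * hed
      - 4 * u * hl + (4 * u * (1 - u * (1 + x + x ^ 2))) * hd_def

theorem sqrt_five_bounds : (2.236 : ℝ) < √5 ∧ √5 < 2.237 :=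
  ⟨Real.lt_sqrt_of_sq_lt (by norm_num), (Real.sqrt_lt' (by norm_num)).mpr (by norm_num)⟩

theorem rescaledCoupling_bounds {u x l h : ℝ} (hl : l * 9.8697 < 2.236 * (u * x ^ 2))
    (hh : 2.237 * (u * x ^ 2) < h * 9.8695) (hu : 0 < u * x ^ 2) (hl0 : 0 < l) :
    l < rescaledCoupling u x ∧ rescaledCoupling u x < h := by
  obtain ⟨h1, h2⟩ := sqrt_five_bounds
  have hpi : (9.8695 : ℝ) < π ^ 2 := by nlinarith [Real.pi_gt_d6]
  have hpi' : π ^ 2 < 9.8697 := by nlinarith [Real.pi_lt_d6, Real.pi_pos]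
  have hh0 : 0 < h := by nlinarith
  unfold rescaledCoupling
  rw [lt_div_iff₀ (by positivity), div_lt_iff₀ (by positivity)]
  constructor
  · nlinarith
  · nlinarith

theorem rescaledCoupling_neg (u x : ℝ) : rescaledCoupling (-u) x = -rescaledCoupling u x := by
  unfold rescaledCoupling; ring

theorem exists_rescaled_FP2 : ∃ u x : ℝ, u ∈ Set.Icc (1.2475 : ℝ) 1.248 ∧
    x ∈ Set.Ioo (-0.0302 : ℝ) (-0.0272) ∧
    25 * u ^ 2 * x ^ 2 + (30 * u ^ 3 - 18 * u - 15) * x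
      + (30 * u ^ 3 + 11 * u ^ 2 - 72 * u + 15) = 0 ∧
    x * (12 / 5) * (1 - 5 / 6 * u * (1 + x))
      - (1 - 2 / 5 * u - u ^ 2 / 3 * (1 + x)) * (1 - u * (1 + x + x ^ 2)) = 0 := by
  obtain ⟨u, hu, x, hx, hbr, hF⟩ := exists_quadratic_root_eq_zero
    (a := fun u => 25 * u ^ 2) (b := fun u => 30 * u ^ 3 - 18 * u - 15)
    (c := fun u => 30 * u ^ 3 + 11 * u ^ 2 - 72 * u + 15)
    (F := fun u x => x * (12 / 5) * (1 - 5 / 6 * u * (1 + x))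
      - (1 - 2 / 5 * u - u ^ 2 / 3 * (1 + x)) * (1 - u * (1 + x + x ^ 2)))
    (σ := 1) (p := 1.2475) (q := 1.248) (y := -0.0302) (by norm_num) (by norm_num)
    (by fun_prop) (by fun_prop) (by fun_prop) (by fun_prop)
    (fun u hu => by have := hu.1; positivity)
    (fun u hu => by
      obtain ⟨h1, h2⟩ := hu
      nlinarith [mul_nonneg (sub_nonneg.mpr h1) (sub_nonneg.mpr h2)])
    (fun x hx hbr => by
      have h1 := lt_larger_quadratic_root (l := -0.02748) (by norm_num) hx (by linarith)
        (by norm_num)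
      have h2 := larger_quadratic_root_lt (h := -0.02746) (by norm_num) hx
        (by norm_num) (by norm_num)
      norm_num at h1 h2 ⊢
      nlinarith [mul_pos (sub_pos.mpr h1) (sub_pos.mpr h2)])
    (fun x hx hbr => by
      have h1 := lt_larger_quadratic_root (l := -0.02996) (by norm_num) hx (by linarith)
        (by norm_num)
      have h2 := larger_quadratic_root_lt (h := -0.02994) (by norm_num) hx
        (by norm_num) (by norm_num)
      norm_num at h1 h2 ⊢
      nlinarith [mul_pos (sub_pos.mpr h1) (sub_pos.mpr h2)])
  have hu' := hu
  obtain ⟨h1, h2⟩ := hu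
  refine ⟨u, x, hu', ⟨lt_larger_quadratic_root (by positivity) hx (by linarith) ?_,
    larger_quadratic_root_lt (by positivity) hx ?_ ?_⟩, hx, hF⟩
  · nlinarith [mul_nonneg (sub_nonneg.mpr h1) (sub_nonneg.mpr h2)]
  · nlinarith [mul_nonneg (sub_nonneg.mpr h1) (sub_nonneg.mpr h2)]
  · nlinarith [mul_nonneg (sub_nonneg.mpr h1) (sub_nonneg.mpr h2)]

theorem exists_rescaled_FP3 : ∃ u x : ℝ, u ∈ Set.Icc (-1.67 : ℝ) (-1.665) ∧
    x ∈ Set.Ioo (0.242 : ℝ) 0.2545 ∧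
    25 * u ^ 2 * x ^ 2 + (30 * u ^ 3 - 18 * u - 15) * x
      + (30 * u ^ 3 + 11 * u ^ 2 - 72 * u + 15) = 0 ∧
    x * (12 / 5) * (1 - 5 / 6 * u * (1 + x))
      - (1 - 2 / 5 * u - u ^ 2 / 3 * (1 + x)) * (1 - u * (1 + x + x ^ 2)) = 0 := by
  obtain ⟨u, hu, x, hx, hbr, hF⟩ := exists_quadratic_root_eq_zero
    (a := fun u => 25 * u ^ 2) (b := fun u => 30 * u ^ 3 - 18 * u - 15)
    (c := fun u => 30 * u ^ 3 + 11 * u ^ 2 - 72 * u + 15)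
    (F := fun u x => x * (12 / 5) * (1 - 5 / 6 * u * (1 + x))
      - (1 - 2 / 5 * u - u ^ 2 / 3 * (1 + x)) * (1 - u * (1 + x + x ^ 2)))
    (σ := -1) (p := -1.67) (q := -1.665) (y := 0.2545) (by norm_num) (by norm_num)
    (by fun_prop) (by fun_prop) (by fun_prop) (by fun_prop)
    (fun u hu => by have := hu.2; nlinarith)
    (fun u hu => by
      obtain ⟨h1, h2⟩ := hu
      nlinarith [mul_nonneg (sub_nonneg.mpr h1) (sub_nonneg.mpr h2)])
    (fun x hx hbr => by
      have h1 := lt_smaller_quadratic_root (l := 0.243) (by norm_num) hx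
        (by norm_num) (by norm_num)
      have h2 := smaller_quadratic_root_lt (h := 0.2434) (by norm_num) hx (by linarith)
        (by norm_num)
      norm_num at h1 h2 ⊢
      nlinarith [mul_pos (sub_pos.mpr h1) (sub_pos.mpr h2)])
    (fun x hx hbr => by
      have h1 := lt_smaller_quadratic_root (l := 0.254) (by norm_num) hx
        (by norm_num) (by norm_num)
      have h2 := smaller_quadratic_root_lt (h := 0.2543) (by norm_num) hx (by linarith)
        (by norm_num)
      norm_num at h1 h2 ⊢
      nlinarith [mul_pos (sub_pos.mpr h1) (sub_pos.mpr h2)])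
  have hu' := hu
  obtain ⟨h1, h2⟩ := hu
  have ha : 0 < 25 * u ^ 2 := by nlinarith
  refine ⟨u, x, hu', ⟨lt_smaller_quadratic_root ha hx ?_ ?_,
    smaller_quadratic_root_lt ha hx (by linarith) ?_⟩, hx, hF⟩
  · nlinarith [mul_nonneg (sub_nonneg.mpr h1) (sub_nonneg.mpr h2)]
  · nlinarith [mul_nonneg (sub_nonneg.mpr h1) (sub_nonneg.mpr h2)]
  · nlinarith [mul_nonneg (sub_nonneg.mpr h1) (sub_nonneg.mpr h2)]

/-- Existence of the unphysical fixed points FP2 and FP3: there is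
a fixed point with `m̄² ∈ (−1.05, −1.01)` and `λ̄ ∈ (0.0001, 0.0004)`, and a fixed
point with `m̄² ∈ (−0.78, −0.72)` and `λ̄ ∈ (−0.026, −0.020)`, both with anomalous
dimension `η < −2`, violating the physical bound `η > −2`. -/
theorem exists_FP2_FP3 :
    (∃ m lam : ℝ, m ∈ Set.Ioo (-1.05 : ℝ) (-1.01 : ℝ) ∧
      lam ∈ Set.Ioo (0.0001 : ℝ) (0.0004 : ℝ) ∧
      (1 + m ≠ 0) ∧ etaDenom m lam ≠ 0 ∧
      betaM m lam = 0 ∧ betaLam m lam = 0 ∧ eta m lam < -2) ∧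
    (∃ m lam : ℝ, m ∈ Set.Ioo (-0.78 : ℝ) (-0.72 : ℝ) ∧
      lam ∈ Set.Ioo (-0.026 : ℝ) (-0.020 : ℝ) ∧
      (1 + m ≠ 0) ∧ etaDenom m lam ≠ 0 ∧
      betaM m lam = 0 ∧ betaLam m lam = 0 ∧ eta m lam < -2) := by
  constructor
  · obtain ⟨u, x, ⟨hu1, hu2⟩, ⟨hx1, hx2⟩, hm, hl⟩ := exists_rescaled_FP2
    have hx : x ≠ 0 := by linarith
    have hu3 : 1.55625 ≤ u ^ 2 := by nlinarith
    have hu4 : u ^ 2 ≤ 1.55751 := by nlinarith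
    have hd : 0 < 1 - 6 / 5 * u + u ^ 2 / 3 * (1 + x) := by nlinarith
    obtain ⟨hM, hL⟩ := fixed_point_of_rescaled hx hd.ne' hm hl
    have hx3 : 0.00073 ≤ x ^ 2 := by nlinarith
    have hx4 : x ^ 2 ≤ 0.00092 := by nlinarith
    refine ⟨x - 1, rescaledCoupling u x, ⟨by linarith, by linarith⟩,
      rescaledCoupling_bounds (by nlinarith) (by nlinarith) (by positivity) (by norm_num),
      by simpa using hx, ?_, hM, hL, ?_⟩
    · rw [etaDenom_rescaled]
      exact mul_ne_zero (pow_ne_zero 4 hx) hd.ne'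
    · rw [eta_rescaled hx, div_lt_iff₀ hd]
      nlinarith
  · obtain ⟨u, x, ⟨hu1, hu2⟩, ⟨hx1, hx2⟩, hm, hl⟩ := exists_rescaled_FP3
    have hx : x ≠ 0 := by linarith
    have hu3 : 2.772 ≤ u ^ 2 := by nlinarith
    have hd : 0 < 1 - 6 / 5 * u + u ^ 2 / 3 * (1 + x) := by nlinarith
    obtain ⟨hM, hL⟩ := fixed_point_of_rescaled hx hd.ne' hm hl
    have hx3 : 0.0585 ≤ x ^ 2 := by nlinarith
    have hx4 : x ^ 2 ≤ 0.0648 := by nlinarith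
    obtain ⟨hc1, hc2⟩ := rescaledCoupling_bounds (u := -u) (x := x) (l := 0.020) (h := 0.026)
      (by nlinarith) (by nlinarith) (by nlinarith) (by norm_num)
    rw [rescaledCoupling_neg] at hc1 hc2
    refine ⟨x - 1, rescaledCoupling u x, ⟨by linarith, by linarith⟩,
      ⟨by linarith, by linarith⟩, by simpa using hx, ?_, hM, hL, ?_⟩
    · rw [etaDenom_rescaled]
      exact mul_ne_zero (pow_ne_zero 4 hx) hd.ne'
    · rw [eta_rescaled hx, div_lt_iff₀ hd]
      nlinarith
end
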